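/- Let 13/14 < γ < 1 be fixed and ε > 0. Suppose α is irrational and a, q are integers with q ≥ 2, gcd(a,q) = 1, a ≠ 0 and |α − a/q| < 1/q². Set N = q^{29/(55−28γ)} and H = ⌊q^{1/2}⌋. Then for every real u with 1 ≤ u ≤ H and for q sufficiently large, 𝔖(u) = Σ_{1 ≤ h ≤ u} | Σ_{p ≤ N} p^{γ−1} e(αhp²) log p | satisfies 𝔖(u) ≪ u N^{(15γ+13)/29 + ε}, where the inner sum is over primes p ≤ N and the implied constant depends only on γ and ε. -/

import Mathlib

/-- `e2pi x = e^{2πix}`. -/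
noncomputable def e2pi (x : ℝ) : ℂ := Complex.exp (2 * Real.pi * Complex.I * x)

section

open Finset

lemma e2pi_eq (x : ℝ) : e2pi x = Complex.exp (Complex.I * ((2 * Real.pi * x : ℝ) : ℂ)) := by
  unfold e2pi
  push_cast
  ring_nf

lemma norm_e2pi (x : ℝ) : ‖e2pi x‖ = 1 := by
  rw [e2pi_eq, Complex.norm_exp_I_mul_ofReal]

lemma e2pi_add (x y : ℝ) : e2pi (x + y) = e2pi x * e2pi y := by
  simp only [e2pi]
  rw [← Complex.exp_add]
  push_cast
  ring_nf

lemma e2pi_sub_intCast (x : ℝ) (n : ℤ) : e2pi (x - n) = e2pi x := by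
  rw [e2pi, e2pi, Complex.exp_eq_exp_iff_exists_int]
  refine ⟨-n, ?_⟩
  push_cast
  ring

lemma conj_e2pi (x : ℝ) : (starRingEnd ℂ) (e2pi x) = e2pi (-x) := by
  rw [e2pi, e2pi, ← Complex.exp_conj]
  simp [Complex.conj_ofNat]

/-- The distance from `x` to the nearest integer. -/
noncomputable def distInt (x : ℝ) : ℝ := |x - round x|

lemma distInt_nonneg (x : ℝ) : 0 ≤ distInt x := abs_nonneg _

lemma distInt_pos {x : ℝ} (hx : Irrational x) : 0 < distInt x :=
  abs_pos.2 (sub_ne_zero.2 (hx.ne_int _))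

lemma four_mul_distInt_le (x : ℝ) : 4 * distInt x ≤ ‖e2pi x - 1‖ := by
  rw [← e2pi_sub_intCast x (round x), e2pi_eq, Complex.norm_exp_I_mul_ofReal_sub_one,
    Real.norm_eq_abs, abs_mul, abs_two]
  have h := abs_sub_round x
  have hpi := Real.pi_pos
  have key := Real.mul_abs_le_abs_sin (x := 2 * Real.pi * (x - round x) / 2) (by
    rw [show 2 * Real.pi * (x - round x) / 2 = Real.pi * (x - round x) by ring, abs_mul,
      abs_of_pos hpi]
    nlinarith)
  rw [show |2 * Real.pi * (x - round x) / 2| = Real.pi * distInt x by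
    rw [show 2 * Real.pi * (x - round x) / 2 = Real.pi * (x - round x) by ring, abs_mul,
      abs_of_pos hpi, distInt], ← mul_assoc, div_mul_cancel₀ _ hpi.ne'] at key
  linarith

/-- The usual majorant of a linear exponential sum with at most `Y` terms and frequency `x`. -/
noncomputable def geomBound (Y x : ℝ) : ℝ := min Y (1 / distInt x)

lemma geomBound_nonneg {Y : ℝ} (hY : 0 ≤ Y) (x : ℝ) : 0 ≤ geomBound Y x :=
  le_min hY (one_div_nonneg.2 (distInt_nonneg x))

lemma norm_sum_e2pi_linear_le {θ : ℝ} (hθ : Irrational θ) (A B Y : ℕ) (hY : B - A ≤ Y) :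
    ‖∑ n ∈ Ioc A B, e2pi (θ * n)‖ ≤ geomBound Y θ := by
  refine le_min ?_ ?_
  · refine (norm_sum_le _ _).trans ?_
    simp only [norm_e2pi, sum_const, Nat.card_Ioc, nsmul_eq_mul, mul_one]
    exact_mod_cast hY
  · rcases le_total A B with hAB | hAB
    · have tel : (e2pi θ - 1) * ∑ n ∈ Ioc A B, e2pi (θ * n) =
          e2pi (θ * ((B : ℝ) + 1)) - e2pi (θ * ((A : ℝ) + 1)) := by
        induction B, hAB using Nat.le_induction with
        | base => simp
        | succ B hAB ih =>
          rw [sum_Ioc_succ_top hAB, mul_add, ih (by omega)]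
          have : e2pi (θ * ((B : ℝ) + 1 + 1)) = e2pi θ * e2pi (θ * ((B : ℝ) + 1)) := by
            rw [← e2pi_add]
            ring_nf
          push_cast
          rw [this]
          ring
      have h1 := congrArg norm tel
      rw [norm_mul] at h1
      have h2 := norm_sub_le (e2pi (θ * ((B : ℝ) + 1))) (e2pi (θ * ((A : ℝ) + 1)))
      rw [norm_e2pi, norm_e2pi] at h2
      have h3 := four_mul_distInt_le θ
      have h4 := distInt_pos hθ
      rw [le_div_iff₀ h4]
      nlinarith [norm_nonneg (∑ n ∈ Ioc A B, e2pi (θ * n))]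
    · rw [Ioc_eq_empty (by omega)]
      simpa using distInt_nonneg θ

lemma norm_sum_sq_eq (s : Finset ℕ) (z : ℕ → ℂ) :
    ‖∑ n ∈ s, z n‖ ^ 2 = ∑ n ∈ s, ‖z n‖ ^ 2 +
      2 * (∑ m ∈ s, ∑ n ∈ s with n < m, z m * (starRingEnd ℂ) (z n)).re := by
  induction s using Finset.induction_on_max with
  | empty => simp
  | insert a s hs ih =>
    have ha : a ∉ s := fun h => lt_irrefl _ (hs a h)
    rw [sum_insert ha, sum_insert ha, sum_insert ha]
    have h1 : (insert a s).filter (· < a) = s := by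
      ext x
      simp only [mem_filter, mem_insert]
      constructor
      · rintro ⟨rfl | h, h'⟩
        · exact absurd h' (lt_irrefl _)
        · exact h
      · exact fun h => ⟨Or.inr h, hs x h⟩
    have h2 : ∑ m ∈ s, ∑ n ∈ insert a s with n < m, z m * (starRingEnd ℂ) (z n) =
        ∑ m ∈ s, ∑ n ∈ s with n < m, z m * (starRingEnd ℂ) (z n) := by
      refine sum_congr rfl fun m hm => ?_
      rw [filter_insert, if_neg (by have := hs m hm; omega)]
    rw [h1, h2, Complex.sq_norm, Complex.normSq_add,
      ← Complex.sq_norm, ← Complex.sq_norm, ih, ← mul_sum, ← map_sum, Complex.add_re]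
    ring

lemma norm_sum_e2pi_quadratic_sq_le {θ : ℝ} (hθ : Irrational θ) (A B Y : ℕ) (hY : B - A ≤ Y) :
    ‖∑ n ∈ Ioc A B, e2pi (θ * (n : ℝ) ^ 2)‖ ^ 2 ≤
      Y + 2 * ∑ l ∈ Icc 1 Y, geomBound Y (θ * ((2 * l : ℕ) : ℝ)) := by
  rw [norm_sum_sq_eq]
  refine add_le_add ?_ (mul_le_mul_of_nonneg_left ?_ zero_le_two)
  · simp only [norm_e2pi, one_pow, sum_const, Nat.card_Ioc, nsmul_eq_mul, mul_one]
    exact_mod_cast hY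
  · refine (Complex.re_le_norm _).trans ?_
    have reindex : ∑ m ∈ Ioc A B, ∑ n ∈ Ioc A B with n < m,
          e2pi (θ * (m : ℝ) ^ 2) * (starRingEnd ℂ) (e2pi (θ * (n : ℝ) ^ 2)) =
        ∑ l ∈ Icc 1 Y, ∑ n ∈ Ioc A (B - l),
          e2pi (θ * (l : ℝ) ^ 2) * e2pi (θ * ((2 * l : ℕ) : ℝ) * n) := by
      rw [sum_sigma', sum_sigma']
      refine sum_nbij' (fun x => ⟨x.1 - x.2, x.2⟩) (fun x => ⟨x.2 + x.1, x.2⟩) ?_ ?_ ?_ ?_ ?_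
      · rintro ⟨m, n⟩ h
        simp only [mem_sigma, mem_Ioc, mem_filter, mem_Icc] at h ⊢
        omega
      · rintro ⟨l, n⟩ h
        simp only [mem_sigma, mem_Ioc, mem_filter, mem_Icc] at h ⊢
        omega
      · rintro ⟨m, n⟩ h
        simp only [mem_sigma, mem_Ioc, mem_filter] at h
        simp only [Sigma.mk.injEq, heq_eq_eq, and_true]
        omega
      · rintro ⟨l, n⟩ h
        simp
      · rintro ⟨m, n⟩ h
        simp only [mem_sigma, mem_Ioc, mem_filter] at h
        simp only
        rw [conj_e2pi, ← e2pi_add, ← e2pi_add]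
        congr 1
        push_cast [Nat.cast_sub h.2.2.le]
        ring
    rw [reindex]
    refine (norm_sum_le _ _).trans (sum_le_sum fun l hl => ?_)
    rw [mem_Icc] at hl
    rw [← mul_sum, norm_mul, norm_e2pi, one_mul]
    refine norm_sum_e2pi_linear_le (hθ.mul_natCast (by omega)) _ _ _ (by omega)

lemma sum_range_inv_sub_two_le (q : ℕ) {Y : ℝ} (hY : 0 ≤ Y) :
    ∑ r ∈ range (q + 1), (if r ≤ 2 then Y else (q : ℝ) / ((r : ℝ) - 2)) ≤
      3 * Y + q * (1 + Real.log q) := by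
  have hsplit : ∀ r ∈ range (q + 1), (if r ≤ 2 then Y else (q : ℝ) / ((r : ℝ) - 2)) ≤
      (if r ∈ range 3 then Y else 0) + (if r ∈ Icc 3 q then (q : ℝ) / ((r : ℝ) - 2) else 0) := by
    intro r hr
    simp only [mem_range, mem_Icc] at hr ⊢
    by_cases h : r ≤ 2
    · rw [if_pos h, if_pos (by omega), if_neg (by omega), add_zero]
    · rw [if_neg h, if_neg (by omega), if_pos (by omega), zero_add]
  refine (sum_le_sum hsplit).trans ?_
  rw [sum_add_distrib, ← sum_filter, ← sum_filter]
  refine add_le_add ?_ ?_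
  · rw [sum_const, nsmul_eq_mul]
    refine mul_le_mul_of_nonneg_right ?_ hY
    have : #{r ∈ range (q + 1) | r ∈ range 3} ≤ #(range 3) :=
      card_le_card fun r hr => (mem_filter.1 hr).2
    rw [card_range] at this
    exact_mod_cast this
  · have hlog := harmonic_le_one_add_log q
    calc ∑ r ∈ range (q + 1) with r ∈ Icc 3 q, (q : ℝ) / ((r : ℝ) - 2)
        = ∑ i ∈ Icc 1 (q - 2), (q : ℝ) * ((i : ℝ))⁻¹ := by
          refine sum_nbij' (fun r => r - 2) (fun i => i + 2) ?_ ?_ ?_ ?_ ?_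
          · intro r hr
            simp only [mem_filter, mem_range, mem_Icc] at hr ⊢
            omega
          · intro r hr
            simp only [mem_filter, mem_range, mem_Icc] at hr ⊢
            omega
          · intro r hr
            simp only [mem_filter, mem_range, mem_Icc] at hr
            omega
          · intro r hr
            omega
          · intro r hr
            simp only [mem_filter, mem_range, mem_Icc] at hr
            push_cast [Nat.cast_sub (show 2 ≤ r by omega)]
            rw [div_eq_mul_inv]
      _ ≤ ∑ i ∈ Icc 1 q, (q : ℝ) * ((i : ℝ))⁻¹ :=
          sum_le_sum_of_subset_of_nonneg (Icc_subset_Icc le_rfl (by omega))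
            fun _ _ _ => by positivity
      _ ≤ q * (1 + Real.log q) := by
          rw [← mul_sum]
          refine mul_le_mul_of_nonneg_left ?_ (Nat.cast_nonneg q)
          refine le_trans (le_of_eq ?_) hlog
          rw [harmonic_eq_sum_Icc]
          push_cast
          rfl

lemma geomBound_le_of_le_mul_distInt {q r : ℕ} {Y x : ℝ} (h : (r : ℝ) - 2 ≤ q * distInt x) :
    geomBound Y x ≤ if r ≤ 2 then Y else (q : ℝ) / ((r : ℝ) - 2) := by
  split_ifs with hr
  · exact min_le_left _ _
  · refine (min_le_right _ _).trans ?_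
    have hr' : (0 : ℝ) < (r : ℝ) - 2 := by
      have : (3 : ℝ) ≤ r := by exact_mod_cast (by omega : 3 ≤ r)
      linarith
    have hd : 0 < distInt x := by
      rcases (distInt_nonneg x).eq_or_lt with h0 | h0
      · rw [← h0, mul_zero] at h
        linarith
      · exact h0
    rw [div_le_div_iff₀ hd hr']
    linarith

lemma sum_range_geomBound_le {α : ℝ} {a : ℤ} {q : ℕ} (hq : 0 < q) (hcop : Int.gcd a q = 1)
    (hα : |α - (a : ℝ) / (q : ℝ)| < 1 / (q : ℝ) ^ 2) {Y : ℝ} (hY : 0 ≤ Y) (m₀ : ℕ) :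
    ∑ j ∈ range q, geomBound Y (α * ((m₀ + j : ℕ) : ℝ)) ≤
      6 * Y + 2 * q * (1 + Real.log q) := by
  have hq' : (0 : ℝ) < q := by exact_mod_cast hq
  set φ : ℕ → ℝ := fun r => if r ≤ 2 then Y else (q : ℝ) / ((r : ℝ) - 2) with hφ
  have hφ0 : ∀ r, 0 ≤ φ r := by
    intro r
    simp only [hφ]
    split_ifs with h
    · exact hY
    · have : (3 : ℝ) ≤ r := by exact_mod_cast (by omega : 3 ≤ r)
      exact div_nonneg hq'.le (by linarith)
  set s₀ : ℤ := ⌊(q : ℝ) * (α * m₀)⌋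
  set σ : ℕ → ℕ := fun j => ((s₀ + a * j) % q).toNat with hσ
  have hσnn : ∀ j : ℕ, 0 ≤ (s₀ + a * j) % (q : ℤ) := fun j =>
    Int.emod_nonneg _ (by exact_mod_cast hq.ne')
  have hσlt : ∀ j, σ j < q := by
    intro j
    have := Int.emod_lt_of_pos (s₀ + a * j) (by exact_mod_cast hq : (0 : ℤ) < q)
    have := hσnn j
    simp only [hσ]
    omega
  have hterm : ∀ j ∈ range q, geomBound Y (α * ((m₀ + j : ℕ) : ℝ)) ≤ φ (σ j) + φ (q - σ j) := by
    intro j hj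
    rw [mem_range] at hj
    set z := α * ((m₀ + j : ℕ) : ℝ) with hz
    set k := round z
    set s : ℤ := s₀ + a * j with hs
    have e1 : |(q : ℝ) * z - s| < 2 := by
      have hfl : |(q : ℝ) * (α * m₀) - s₀| ≤ 1 := by
        rw [abs_le]
        constructor
        · linarith [Int.floor_le ((q : ℝ) * (α * m₀))]
        · linarith [Int.lt_floor_add_one ((q : ℝ) * (α * m₀))]
      have hqa : |((q : ℝ) * α - a) * j| < 1 := by
        have h1 : (q : ℝ) * α - a = q * (α - a / q) := by field_simp
        rw [h1, abs_mul, abs_mul, abs_of_pos hq', Nat.abs_cast]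
        have h2 : (q : ℝ) * |α - a / q| < 1 / q := by
          calc (q : ℝ) * |α - a / q| < q * (1 / (q : ℝ) ^ 2) := by gcongr
            _ = 1 / q := by field_simp
        have h3 : (j : ℝ) ≤ q := by exact_mod_cast hj.le
        have h4 : (1 / (q : ℝ)) * q = 1 := by field_simp
        calc (q : ℝ) * |α - a / q| * j ≤ (q : ℝ) * |α - a / q| * q := by gcongr
          _ < 1 / q * q := by gcongr
          _ = 1 := h4
      have h5 : (q : ℝ) * z - s = ((q : ℝ) * (α * m₀) - s₀) + ((q : ℝ) * α - a) * j := by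
        rw [hz, hs]
        push_cast
        ring
      rw [h5]
      refine (abs_add_le _ _).trans_lt (by linarith)
    have e2 : (q : ℝ) * distInt z = |(q : ℝ) * z - q * k| := by
      rw [distInt, ← mul_sub, abs_mul, abs_of_pos hq']
    have e3 : |(s : ℝ) - q * k| - 2 ≤ q * distInt z := by
      rw [e2]
      have := abs_sub_abs_le_abs_sub ((s : ℝ) - q * k) ((s : ℝ) - q * z)
      rw [abs_sub_comm (s : ℝ) (q * z)] at this
      rw [show (s : ℝ) - q * k - (s - q * z) = q * z - q * k by ring] at this
      linarith
    have hr : ((σ j : ℕ) : ℤ) = s % q := by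
      simp only [hσ]
      exact Int.toNat_of_nonneg (hσnn j)
    have e4 : (σ j : ℤ) ≤ |s - q * k| ∨ ((q - σ j : ℕ) : ℤ) ≤ |s - q * k| := by
      have hdm := Int.emod_add_mul_ediv s q
      have hlt := hσlt j
      rw [← hr] at hdm
      set t := s / (q : ℤ)
      have hsk : s - q * k = σ j + q * (t - k) := by rw [← hdm]; ring
      rw [hsk]
      rcases le_or_gt 0 (t - k) with h0 | h0
      · left
        have : 0 ≤ (q : ℤ) * (t - k) := by positivity
        rw [abs_of_nonneg (by omega)]
        omega
      · right
        have : (q : ℤ) * (t - k) ≤ q * (-1) := by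
          refine mul_le_mul_of_nonneg_left (by omega) (by positivity)
        rw [abs_of_nonpos (by omega)]
        omega
    rcases e4 with e4 | e4
    · have h6 : ((σ j : ℕ) : ℝ) ≤ |(s : ℝ) - q * k| := by exact_mod_cast e4
      have := geomBound_le_of_le_mul_distInt (q := q) (r := σ j) (Y := Y) (x := z) (by linarith)
      exact this.trans (le_add_of_nonneg_right (hφ0 _))
    · have h6 : ((q - σ j : ℕ) : ℝ) ≤ |(s : ℝ) - q * k| := by exact_mod_cast e4
      have := geomBound_le_of_le_mul_distInt (q := q) (r := q - σ j) (Y := Y) (x := z)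
        (by linarith)
      exact this.trans (le_add_of_nonneg_left (hφ0 _))
  have hinj : Set.InjOn σ (range q : Finset ℕ) := by
    intro i hi j hj hij
    simp only [coe_range, Set.mem_Iio] at hi hj
    have h1 : (s₀ + a * i) % (q : ℤ) = (s₀ + a * j) % q := by
      have := hσnn i
      have := hσnn j
      simp only [hσ] at hij
      omega
    have h2 : (q : ℤ) ∣ a * ((j : ℤ) - i) := by
      have := Int.ModEq.dvd h1
      convert this using 1
      ring
    have h3 : IsCoprime (q : ℤ) a := (Int.isCoprime_iff_gcd_eq_one.2 hcop).symm
    obtain ⟨c, hc⟩ := h3.dvd_of_dvd_mul_left h2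
    have hc0 : c = 0 := by
      by_contra hne
      rcases lt_or_gt_of_ne hne with h | h
      · have : (q : ℤ) * c ≤ q * (-1) := mul_le_mul_of_nonneg_left (by omega) (by positivity)
        omega
      · have : (q : ℤ) * 1 ≤ q * c := mul_le_mul_of_nonneg_left (by omega) (by positivity)
        omega
    rw [hc0, mul_zero] at hc
    omega
  have hsum := sum_range_inv_sub_two_le q hY
  calc ∑ j ∈ range q, geomBound Y (α * ((m₀ + j : ℕ) : ℝ))
      ≤ ∑ j ∈ range q, (φ (σ j) + φ (q - σ j)) := sum_le_sum hterm
    _ = ∑ r ∈ (range q).image σ, (φ r + φ (q - r)) := (sum_image (f := fun r => φ r + φ (q - r)) hinj).symm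
    _ ≤ ∑ r ∈ range (q + 1), (φ r + φ (q - r)) := by
        refine sum_le_sum_of_subset_of_nonneg ?_ fun r _ _ => add_nonneg (hφ0 _) (hφ0 _)
        intro r hr
        obtain ⟨j, _, rfl⟩ := mem_image.1 hr
        exact mem_range.2 ((hσlt j).trans (Nat.lt_succ_self q))
    _ = ∑ r ∈ range (q + 1), φ r + ∑ r ∈ range (q + 1), φ r := by
        rw [sum_add_distrib]
        congr 1
        have := sum_range_reflect φ (q + 1)
        simpa using this
    _ ≤ 6 * Y + 2 * q * (1 + Real.log q) := by
        simp only [hφ]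
        linarith

lemma sum_Icc_geomBound_le {α : ℝ} {a : ℤ} {q : ℕ} (hq : 0 < q) (hcop : Int.gcd a q = 1)
    (hα : |α - (a : ℝ) / (q : ℝ)| < 1 / (q : ℝ) ^ 2) {Y : ℝ} (hY : 0 ≤ Y) (X : ℕ) :
    ∑ m ∈ Icc 1 X, geomBound Y (α * m) ≤
      ((X : ℝ) / q + 1) * (6 * Y + 2 * q * (1 + Real.log q)) := by
  have hblocks : ∀ K : ℕ, ∑ m ∈ range (q * K), geomBound Y (α * m) ≤
      K * (6 * Y + 2 * q * (1 + Real.log q)) := by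
    intro K
    induction K with
    | zero => simp
    | succ K ih =>
      rw [mul_add, mul_one, sum_range_add]
      have := sum_range_geomBound_le hq hcop hα hY (q * K)
      push_cast at this ⊢
      linarith
  have hlog : 0 ≤ Real.log q := Real.log_natCast_nonneg q
  calc ∑ m ∈ Icc 1 X, geomBound Y (α * m)
      ≤ ∑ m ∈ range (q * (X / q + 1)), geomBound Y (α * m) := by
        refine sum_le_sum_of_subset_of_nonneg ?_ fun _ _ _ => geomBound_nonneg hY _
        intro m hm
        rw [mem_Icc] at hm
        rw [mem_range]
        exact hm.2.trans_lt (Nat.lt_mul_div_succ X hq)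
    _ ≤ ((X / q + 1 : ℕ) : ℝ) * (6 * Y + 2 * q * (1 + Real.log q)) := hblocks _
    _ ≤ ((X : ℝ) / q + 1) * (6 * Y + 2 * q * (1 + Real.log q)) := by
        refine mul_le_mul_of_nonneg_right ?_ (by positivity)
        push_cast
        have : ((X / q : ℕ) : ℝ) ≤ (X : ℝ) / q := Nat.cast_div_le
        linarith

lemma sum_triple_geomBound_le {ι : Type*} [DecidableEq ι] (T : Finset ι) (κ : ι → ℕ) {R K D u Y : ℕ}
    (hκ : ∀ t ∈ T, 1 ≤ κ t) (hκK : ∀ t ∈ T, κ t ≤ K) (hR : ∀ k, #{t ∈ T | κ t = k} ≤ R)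
    (hD : ∀ m, 1 ≤ m → m ≤ 2 * u * K * Y → #m.divisors ≤ D) (α : ℝ) :
    ∑ h ∈ Icc 1 u, ∑ t ∈ T, ∑ l ∈ Icc 1 Y, geomBound Y (α * ((h * κ t * (2 * l) : ℕ) : ℝ)) ≤
      R * D ^ 2 * ∑ m ∈ Icc 1 (2 * u * K * Y), geomBound Y (α * m) := by
  set S : Finset (ℕ × ι × ℕ) := Icc 1 u ×ˢ T ×ˢ Icc 1 Y with hS
  set g : ℕ × ι × ℕ → ℕ := fun x => x.1 * κ x.2.1 * (2 * x.2.2) with hg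
  have hmaps : ∀ x ∈ S, g x ∈ Icc 1 (2 * u * K * Y) := by
    rintro ⟨h, t, l⟩ hx
    simp only [hS, mem_product, mem_Icc] at hx
    obtain ⟨⟨h1, h2⟩, ht, h3, h4⟩ := hx
    have h5 := hκ t ht
    have h6 := hκK t ht
    simp only [hg, mem_Icc]
    constructor
    · have : 0 < h * κ t * (2 * l) := by positivity
      omega
    · calc h * κ t * (2 * l) ≤ u * K * (2 * Y) := by gcongr
        _ = 2 * u * K * Y := by ring
  have hfib : ∀ m ∈ Icc 1 (2 * u * K * Y), #{x ∈ S | g x = m} ≤ R * D ^ 2 := by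
    intro m hm
    rw [mem_Icc] at hm
    have himg : ({x ∈ S | g x = m}).image (fun x => (x.1, x.2.2)) ⊆ m.divisors ×ˢ m.divisors := by
      intro y hy
      obtain ⟨⟨h, t, l⟩, hx, rfl⟩ := mem_image.1 hy
      have hx2 := (mem_filter.1 hx).2
      simp only [hg] at hx2
      simp only [mem_product, Nat.mem_divisors]
      refine ⟨⟨⟨κ t * (2 * l), ?_⟩, by omega⟩, ⟨⟨h * κ t * 2, ?_⟩, by omega⟩⟩ <;>
        rw [← hx2] <;> ring
    have hcard : ∀ y ∈ ({x ∈ S | g x = m}).image (fun x => (x.1, x.2.2)),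
        #{x ∈ {x ∈ S | g x = m} | (x.1, x.2.2) = y} ≤ R := by
      rintro ⟨h, l⟩ -
      by_cases hhl : h * (2 * l) = 0
      · rw [card_eq_zero.2]
        · exact Nat.zero_le _
        · rw [filter_eq_empty_iff]
          rintro ⟨h', t, l'⟩ hx hxy
          simp only [Prod.mk.injEq] at hxy
          have := (mem_filter.1 hx).2
          simp only [hg, hxy.1, hxy.2] at this
          have h7 : h * κ t * (2 * l) = h * (2 * l) * κ t := by ring
          rw [h7, hhl, zero_mul] at this
          omega
      · refine le_trans ?_ (hR (m / (h * (2 * l))))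
        refine card_le_card_of_injOn (fun x => x.2.1) ?_ ?_
        · rintro ⟨h', t, l'⟩ hx
          simp only [coe_filter, Set.mem_ofPred_eq, hS, hg, mem_filter, mem_product,
            Prod.mk.injEq] at hx ⊢
          obtain ⟨⟨⟨_, ht, _⟩, h8⟩, rfl, rfl⟩ := hx
          refine ⟨ht, ?_⟩
          rw [← h8, show h' * κ t * (2 * l') = h' * (2 * l') * κ t by ring,
            Nat.mul_div_cancel_left _ (Nat.pos_of_ne_zero hhl)]
        · rintro ⟨h', t, l'⟩ hx ⟨h'', t', l''⟩ hx' htt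
          simp only [coe_filter, Set.mem_ofPred_eq, mem_filter, Prod.mk.injEq] at hx hx' htt ⊢
          exact ⟨hx.2.1.trans hx'.2.1.symm, htt, hx.2.2.trans hx'.2.2.symm⟩
    calc #{x ∈ S | g x = m}
        ≤ R * #(({x ∈ S | g x = m}).image (fun x => (x.1, x.2.2))) :=
          card_le_mul_card_image _ _ hcard
      _ ≤ R * (#m.divisors * #m.divisors) := by
          refine Nat.mul_le_mul_left _ ?_
          rw [← card_product]
          exact card_le_card himg
      _ ≤ R * D ^ 2 := by
          have := hD m hm.1 hm.2
          rw [sq]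
          gcongr
  calc ∑ h ∈ Icc 1 u, ∑ t ∈ T, ∑ l ∈ Icc 1 Y, geomBound Y (α * ((h * κ t * (2 * l) : ℕ) : ℝ))
      = ∑ x ∈ S, geomBound Y (α * (g x : ℝ)) := by
        rw [hS, sum_product]
        refine sum_congr rfl fun h _ => ?_
        rw [sum_product]
    _ = ∑ m ∈ Icc 1 (2 * u * K * Y), ∑ x ∈ S with g x = m, geomBound Y (α * (g x : ℝ)) :=
        (sum_fiberwise_of_maps_to hmaps _).symm
    _ ≤ ∑ m ∈ Icc 1 (2 * u * K * Y), (R * D ^ 2 : ℝ) * geomBound Y (α * m) := by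
        refine sum_le_sum fun m hm => ?_
        rw [sum_congr rfl (fun x hx => by rw [(mem_filter.1 hx).2]), sum_const, nsmul_eq_mul]
        refine mul_le_mul_of_nonneg_right ?_ (geomBound_nonneg (Nat.cast_nonneg _) _)
        exact_mod_cast hfib m hm
    _ = _ := by rw [mul_sum]

lemma sum_norm_quadratic_sq_le {ι : Type*} [DecidableEq ι] (T : Finset ι) (κ : ι → ℕ)
    {R K D u Y : ℕ} (hκ : ∀ t ∈ T, 1 ≤ κ t) (hκK : ∀ t ∈ T, κ t ≤ K)
    (hR : ∀ k, #{t ∈ T | κ t = k} ≤ R)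
    (hD : ∀ m, 1 ≤ m → m ≤ 2 * u * K * Y → #m.divisors ≤ D)
    {α : ℝ} {a : ℤ} {q : ℕ} (hirr : Irrational α) (hq : 0 < q) (hcop : Int.gcd a q = 1)
    (hα : |α - (a : ℝ) / (q : ℝ)| < 1 / (q : ℝ) ^ 2)
    (A B : ℕ → ι → ℕ) (hAB : ∀ h, ∀ t ∈ T, B h t - A h t ≤ Y) :
    ∑ h ∈ Icc 1 u, ∑ t ∈ T,
        ‖∑ n ∈ Ioc (A h t) (B h t), e2pi (α * ((h * κ t : ℕ) : ℝ) * (n : ℝ) ^ 2)‖ ^ 2 ≤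
      u * #T * Y + 2 * (R * D ^ 2 * (((2 * u * K * Y : ℕ) : ℝ) / q + 1) *
        (6 * Y + 2 * q * (1 + Real.log q))) := by
  calc _ ≤ ∑ h ∈ Icc 1 u, ∑ t ∈ T,
        ((Y : ℝ) + 2 * ∑ l ∈ Icc 1 Y, geomBound Y (α * ((h * κ t * (2 * l) : ℕ) : ℝ))) := by
        refine sum_le_sum fun h hh => sum_le_sum fun t ht => ?_
        have h1 := (mem_Icc.1 hh).1
        have h2 := hκ t ht
        have h3 : h * κ t ≠ 0 := by positivity
        refine (norm_sum_e2pi_quadratic_sq_le (hirr.mul_natCast h3) _ _ Y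
          (hAB h t ht)).trans (le_of_eq ?_)
        congr 2
        refine sum_congr rfl fun l _ => ?_
        congr 1
        push_cast
        ring
    _ = u * #T * Y + 2 * ∑ h ∈ Icc 1 u, ∑ t ∈ T, ∑ l ∈ Icc 1 Y,
          geomBound Y (α * ((h * κ t * (2 * l) : ℕ) : ℝ)) := by
        simp only [sum_add_distrib, sum_const, Nat.card_Icc, nsmul_eq_mul, mul_sum]
        simp [mul_assoc]
    _ ≤ _ := by
        have h1 := sum_triple_geomBound_le T κ hκ hκK hR hD α
        have h2 := sum_Icc_geomBound_le hq hcop hα (Nat.cast_nonneg Y) (2 * u * K * Y)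
        have h3 : (0 : ℝ) ≤ R * D ^ 2 := by positivity
        have h4 := mul_le_mul_of_nonneg_left h2 h3
        linarith

lemma sum_sum_le_of_sum_sq_le {ι κ : Type*} (s : Finset ι) (t : Finset κ) (f : ι → κ → ℝ) {A B : ℝ}
    (hB : 0 ≤ B) (hA : ∑ i ∈ s, ∑ j ∈ t, f i j ^ 2 ≤ A) (hAB : #s * #t * A ≤ B ^ 2) :
    ∑ i ∈ s, ∑ j ∈ t, f i j ≤ B := by
  refine le_of_sq_le_sq ?_ hB
  rw [← sum_product'] at hA ⊢
  refine sq_sum_le_card_mul_sum_sq.trans (le_trans ?_ hAB)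
  rw [card_product, Nat.cast_mul]
  gcongr

lemma sum_norm_typeI_le {N q u D w : ℕ} (hw : 1 ≤ w) (hu : 1 ≤ u) (huN : u ≤ N) (hqN : q ≤ N)
    (hwq : w ^ 11 ≤ q) (hD : ∀ m, 1 ≤ m → m ≤ 2 * N ^ 4 → #m.divisors ≤ D)
    (hlog : 1 + Real.log N ≤ D)
    {α : ℝ} {a : ℤ} (hirr : Irrational α) (hcop : Int.gcd a q = 1)
    (hα : |α - (a : ℝ) / (q : ℝ)| < 1 / (q : ℝ) ^ 2)
    (B : ℕ → ℕ → ℕ) (hB : ∀ h d, B h d ≤ N) :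
    ∑ h ∈ Icc 1 u, ∑ d ∈ Icc 1 (w ^ 3),
        ‖∑ n ∈ Ioc 0 (B h d), e2pi (α * (h : ℝ) * ((d * n : ℕ) : ℝ) ^ 2)‖ ≤
      7 * D ^ 2 * u * N / w := by
  have hq : 0 < q := lt_of_lt_of_le (by positivity) hwq
  have hN : 0 < N := by omega
  have hwN : w ^ 3 ≤ N := ((Nat.pow_le_pow_right hw (by norm_num : 3 ≤ 11)).trans hwq).trans hqN
  have hD1 : (1 : ℝ) ≤ D := by
    have := Real.log_natCast_nonneg N
    linarith
  have hsq := sum_norm_quadratic_sq_le (Icc 1 (w ^ 3)) (fun d => d ^ 2) (R := 1) (K := (w ^ 3) ^ 2)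
    (D := D) (u := u) (Y := N) (fun t ht => Nat.one_le_pow _ _ (mem_Icc.1 ht).1)
    (fun t ht => Nat.pow_le_pow_left (mem_Icc.1 ht).2 2)
    (fun k => card_le_one.2 fun x hx y hy =>
      Nat.pow_left_injective (n := 2) (by norm_num)
        ((mem_filter.1 hx).2.trans (mem_filter.1 hy).2.symm))
    (fun m h1 h2 => hD m h1 (h2.trans (by
      calc 2 * u * (w ^ 3) ^ 2 * N ≤ 2 * N * N ^ 2 * N := by gcongr
        _ = 2 * N ^ 4 := by ring)))
    hirr hq hcop hα (fun _ _ => 0) B (fun h t _ => by simpa using hB h t)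
  refine sum_sum_le_of_sum_sq_le _ _ _ (A := 49 * D ^ 3 * u * (w : ℝ) ^ 6 * N ^ 2 / q)
    (by positivity) ?_ ?_
  · refine le_trans (le_of_eq ?_) (hsq.trans ?_)
    · refine sum_congr rfl fun h _ => sum_congr rfl fun d _ => ?_
      congr 2
      refine sum_congr rfl fun n _ => ?_
      congr 1
      push_cast
      ring
    · rw [Nat.card_Icc, Nat.add_sub_cancel]
      push_cast
      have hq' : (0 : ℝ) < q := by exact_mod_cast hq
      have hqN' : (q : ℝ) ≤ N := by exact_mod_cast hqN
      have hw' : (1 : ℝ) ≤ w := by exact_mod_cast hw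
      have hu' : (1 : ℝ) ≤ u := by exact_mod_cast hu
      have hN' : (0 : ℝ) < N := by exact_mod_cast hN
      have hlq : Real.log q ≤ Real.log N := Real.log_le_log hq' hqN'
      have hlq0 : 0 ≤ Real.log q := Real.log_natCast_nonneg q
      have e1 : 6 * (N : ℝ) + 2 * q * (1 + Real.log q) ≤ 8 * D * N := by
        have : (2 : ℝ) * q * (1 + Real.log q) ≤ 2 * N * D := by
          gcongr
          linarith
        nlinarith
      have e2 : 1 ≤ u * (w : ℝ) ^ 6 * N / q := by
        rw [one_le_div hq']
        have h6 : (1 : ℝ) ≤ (w : ℝ) ^ 6 := one_le_pow₀ hw'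
        calc (q : ℝ) ≤ N := hqN'
          _ = 1 * 1 * N := by ring
          _ ≤ u * (w : ℝ) ^ 6 * N := by gcongr
      have e3 : (u : ℝ) * (w : ℝ) ^ 3 * N ≤ D ^ 3 * u * (w : ℝ) ^ 6 * N ^ 2 / q := by
        rw [le_div_iff₀ hq']
        have h3 : (1 : ℝ) ≤ (w : ℝ) ^ 3 := one_le_pow₀ hw'
        have h4 : (1 : ℝ) ≤ (D : ℝ) ^ 3 := one_le_pow₀ hD1
        calc (u : ℝ) * (w : ℝ) ^ 3 * N * q = 1 * u * ((w : ℝ) ^ 3 * 1) * (N * q) := by ring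
          _ ≤ D ^ 3 * u * ((w : ℝ) ^ 3 * (w : ℝ) ^ 3) * (N * N) := by gcongr
          _ = _ := by ring
      have e4 : 2 * (1 * (D : ℝ) ^ 2 * (2 * u * ((w : ℝ) ^ 3) ^ 2 * N / q + 1) *
          (6 * N + 2 * q * (1 + Real.log q))) ≤
          2 * (1 * (D : ℝ) ^ 2 * (3 * (u * (w : ℝ) ^ 6 * N / q)) * (8 * D * N)) := by
        gcongr
        have : 2 * (u : ℝ) * ((w : ℝ) ^ 3) ^ 2 * N / q = 2 * (u * (w : ℝ) ^ 6 * N / q) := by ring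
        rw [this]
        linarith
      calc _ ≤ _ := add_le_add e3 e4
        _ = _ := by ring
  · rw [Nat.card_Icc, Nat.card_Icc, Nat.add_sub_cancel, Nat.add_sub_cancel]
    have hq' : (0 : ℝ) < q := by exact_mod_cast hq
    have hw' : (1 : ℝ) ≤ w := by exact_mod_cast hw
    have hwq' : (w : ℝ) ^ 11 ≤ q := by exact_mod_cast hwq
    push_cast
    rw [div_pow, mul_div_assoc', div_le_div_iff₀ hq' (by positivity)]
    calc (u : ℝ) * (w : ℝ) ^ 3 * (49 * D ^ 3 * u * (w : ℝ) ^ 6 * N ^ 2) * (w : ℝ) ^ 2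
        = 49 * (1 * D ^ 3) * u ^ 2 * N ^ 2 * (w : ℝ) ^ 11 := by ring
      _ ≤ 49 * ((D : ℝ) * D ^ 3) * u ^ 2 * N ^ 2 * q := by gcongr
      _ = _ := by ring

lemma card_filter_sq_sub_sq_le {P D : ℕ} (s : Finset (ℕ × ℕ)) (hs : ∀ x ∈ s, x.2 < x.1 ∧ x.1 ≤ P)
    (hD : ∀ m, 1 ≤ m → m ≤ P ^ 2 → #m.divisors ≤ D) (k : ℕ) :
    #{x ∈ s | x.1 ^ 2 - x.2 ^ 2 = k} ≤ D := by
  rcases ({x ∈ s | x.1 ^ 2 - x.2 ^ 2 = k}).eq_empty_or_nonempty with h | ⟨y, hy⟩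
  · rw [h]
    exact Nat.zero_le _
  · have hk : 1 ≤ k ∧ k ≤ P ^ 2 := by
      obtain ⟨hys, rfl⟩ := mem_filter.1 hy
      obtain ⟨h1, h2⟩ := hs y hys
      have h3 := Nat.pow_lt_pow_left h1 (n := 2) (by norm_num)
      have h4 := Nat.pow_le_pow_left h2 2
      omega
    refine le_trans ?_ (hD k hk.1 hk.2)
    refine card_le_card_of_injOn (fun x => x.1 - x.2) ?_ ?_
    · rintro x hx
      simp only [coe_filter, Set.mem_ofPred_eq] at hx
      simp only [mem_coe, Nat.mem_divisors]
      refine ⟨⟨x.1 + x.2, ?_⟩, by omega⟩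
      rw [← hx.2, Nat.sq_sub_sq, mul_comm]
    · rintro ⟨x, x'⟩ hx ⟨y, y'⟩ hy hxy
      simp only [coe_filter, Set.mem_ofPred_eq] at hx hy hxy
      have h1 := (hs _ hx.1).1
      have h2 := (hs _ hy.1).1
      simp only at h1 h2
      have h3 := hx.2.trans hy.2.symm
      rw [Nat.sq_sub_sq, Nat.sq_sub_sq, hxy] at h3
      have h4 := Nat.eq_of_mul_eq_mul_right (by omega) h3
      simp only [Prod.mk.injEq]
      omega

/-- The pairs of elements of `(w, P]` in decreasing order. -/
def decreasingPairs (w P : ℕ) : Finset (ℕ × ℕ) := {x ∈ Ioc w P ×ˢ Ioc w P | x.2 < x.1}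

lemma typeII_parameter_bound {u P Q q w D N : ℝ} (hu : 1 ≤ u) (hP : 0 ≤ P) (hQ : 1 ≤ Q)
    (hQN : Q ≤ N) (hq : 0 < q) (hqN : q ≤ N) (hwQ : w ^ 2 ≤ Q) (hwq : w ^ 2 ≤ q)
    (hD : 1 ≤ D ^ 4) (hPQ : P * Q ≤ N) :
    u * P ^ 2 * (u * P ^ 2 * Q + 16 * D ^ 4 * ((2 * u * P ^ 2 * Q / q + 1) * (Q + q))) *
      (w * Q) ^ 2 ≤ (10 * D ^ 2 * u * N ^ 2) ^ 2 := by
  have hN : 0 < N := by linarith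
  have hX4 : (P * Q) ^ 4 ≤ N ^ 4 := by gcongr
  have hX2 : (P * Q) ^ 2 ≤ N ^ 2 := by gcongr
  have hw2 : 0 ≤ w ^ 2 := sq_nonneg w
  have hu2 : u ≤ u ^ 2 := by nlinarith
  have a1 : u ^ 2 * (P * Q) ^ 4 * (w ^ 2 / Q) ≤ D ^ 4 * u ^ 2 * N ^ 4 := by
    calc u ^ 2 * (P * Q) ^ 4 * (w ^ 2 / Q) ≤ u ^ 2 * N ^ 4 * 1 := by
          gcongr
          exact div_le_one_of_le₀ hwQ (by linarith)
      _ = 1 * u ^ 2 * N ^ 4 := by ring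
      _ ≤ D ^ 4 * u ^ 2 * N ^ 4 := by gcongr
  have a2 : D ^ 4 * (u ^ 2 * (P * Q) ^ 4 * (w ^ 2 / Q)) ≤ D ^ 4 * u ^ 2 * N ^ 4 := by
    calc D ^ 4 * (u ^ 2 * (P * Q) ^ 4 * (w ^ 2 / Q)) ≤ D ^ 4 * (u ^ 2 * N ^ 4 * 1) := by
          gcongr
          exact div_le_one_of_le₀ hwQ (by linarith)
      _ = D ^ 4 * u ^ 2 * N ^ 4 := by ring
  have a3 : D ^ 4 * (u ^ 2 * (P * Q) ^ 4 * (w ^ 2 / q)) ≤ D ^ 4 * u ^ 2 * N ^ 4 := by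
    calc D ^ 4 * (u ^ 2 * (P * Q) ^ 4 * (w ^ 2 / q)) ≤ D ^ 4 * (u ^ 2 * N ^ 4 * 1) := by
          gcongr
          exact div_le_one_of_le₀ hwq hq.le
      _ = D ^ 4 * u ^ 2 * N ^ 4 := by ring
  have a4 : D ^ 4 * (u * (P * Q) ^ 2 * (w ^ 2 * (Q + q))) ≤ 2 * (D ^ 4 * u ^ 2 * N ^ 4) := by
    calc D ^ 4 * (u * (P * Q) ^ 2 * (w ^ 2 * (Q + q)))
        ≤ D ^ 4 * (u ^ 2 * N ^ 2 * (N * (N + N))) := by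
          gcongr
          exact hwQ.trans hQN
      _ = 2 * (D ^ 4 * u ^ 2 * N ^ 4) := by ring
  have e : u * P ^ 2 * (u * P ^ 2 * Q + 16 * D ^ 4 * ((2 * u * P ^ 2 * Q / q + 1) * (Q + q))) *
      (w * Q) ^ 2 = u ^ 2 * (P * Q) ^ 4 * (w ^ 2 / Q) +
        32 * (D ^ 4 * (u ^ 2 * (P * Q) ^ 4 * (w ^ 2 / q))) +
        32 * (D ^ 4 * (u ^ 2 * (P * Q) ^ 4 * (w ^ 2 / Q))) +
        16 * (D ^ 4 * (u * (P * Q) ^ 2 * (w ^ 2 * (Q + q)))) := by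
    have : Q ≠ 0 := by linarith
    field_simp
    ring
  rw [e]
  have hZ : 0 ≤ D ^ 4 * u ^ 2 * N ^ 4 := by positivity
  have e5 : (10 * D ^ 2 * u * N ^ 2) ^ 2 = 100 * (D ^ 4 * u ^ 2 * N ^ 4) := by ring
  rw [e5]
  linarith

lemma sum_norm_typeII_pairs_le {N q u D w Q P : ℕ} (hw : 1 ≤ w) (hu : 1 ≤ u) (huN : u ≤ N)
    (hqN : q ≤ N) (hwq : w ^ 11 ≤ q) (hD : ∀ m, 1 ≤ m → m ≤ 2 * N ^ 4 → #m.divisors ≤ D)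
    (hlog : 1 + Real.log N ≤ D)
    {α : ℝ} {a : ℤ} (hirr : Irrational α) (hcop : Int.gcd a q = 1)
    (hα : |α - (a : ℝ) / (q : ℝ)| < 1 / (q : ℝ) ^ 2)
    (hwQ : w ^ 2 ≤ Q) (hP1 : 1 ≤ P) (hPQ : P * Q ≤ N) (M : ℕ → ℕ) :
    ∑ h ∈ Icc 1 u, ∑ x ∈ decreasingPairs w P,
        ‖∑ m ∈ Ioc (Q - 1) (min (2 * Q - 1) (M h / x.1)),
          e2pi (α * ((h * (x.1 ^ 2 - x.2 ^ 2) : ℕ) : ℝ) * (m : ℝ) ^ 2)‖ ≤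
      10 * D ^ 2 * u * N ^ 2 / (w * Q) := by
  have hq : 0 < q := lt_of_lt_of_le (by positivity) hwq
  have hN : 0 < N := by omega
  have hQ1 : 1 ≤ Q := le_trans (Nat.one_le_pow _ _ hw) hwQ
  have hPN : P ≤ N := le_trans (by nlinarith) hPQ
  have hQN : Q ≤ N := le_trans (by nlinarith) hPQ
  have hlt : ∀ x ∈ decreasingPairs w P, x.2 < x.1 ∧ x.1 ≤ P := by
    intro x hx
    simp only [decreasingPairs, mem_filter, mem_product, mem_Ioc] at hx
    omega
  have hD1 : (1 : ℝ) ≤ D := by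
    have := Real.log_natCast_nonneg N
    linarith
  have hcardT : #(decreasingPairs w P) ≤ P ^ 2 := by
    refine (card_filter_le _ _).trans ?_
    rw [card_product, Nat.card_Ioc, sq]
    exact Nat.mul_le_mul (Nat.sub_le _ _) (Nat.sub_le _ _)
  have hsq := sum_norm_quadratic_sq_le (decreasingPairs w P) (fun x => x.1 ^ 2 - x.2 ^ 2) (R := D)
    (K := P ^ 2) (D := D) (u := u) (Y := Q)
    (fun t ht => by
      have := Nat.pow_lt_pow_left (hlt t ht).1 (n := 2) (by norm_num)
      omega)
    (fun t ht => (Nat.sub_le _ _).trans (Nat.pow_le_pow_left (hlt t ht).2 2))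
    (card_filter_sq_sub_sq_le _ hlt fun m h1 h2 => hD m h1 (h2.trans (by
      calc P ^ 2 ≤ N ^ 2 := Nat.pow_le_pow_left hPN 2
        _ ≤ N ^ 4 := Nat.pow_le_pow_right hN (by norm_num)
        _ ≤ 2 * N ^ 4 := by omega)))
    (fun m h1 h2 => hD m h1 (h2.trans (by
      calc 2 * u * P ^ 2 * Q ≤ 2 * N * N ^ 2 * N := by gcongr
        _ = 2 * N ^ 4 := by ring)))
    hirr hq hcop hα (fun _ _ => Q - 1) (fun h x => min (2 * Q - 1) (M h / x.1))
    (fun h t _ => by omega)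
  have hq' : (0 : ℝ) < q := by exact_mod_cast hq
  have hqN' : (q : ℝ) ≤ N := by exact_mod_cast hqN
  have hw' : (1 : ℝ) ≤ w := by exact_mod_cast hw
  have hu' : (1 : ℝ) ≤ u := by exact_mod_cast hu
  have hN' : (1 : ℝ) ≤ N := by exact_mod_cast hN
  have hQ' : (1 : ℝ) ≤ Q := by exact_mod_cast hQ1
  have hP' : (1 : ℝ) ≤ P := by exact_mod_cast hP1
  have hPQ' : (P : ℝ) * Q ≤ N := by exact_mod_cast hPQ
  have hQN' : (Q : ℝ) ≤ N := by exact_mod_cast hQN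
  have hwQ' : (w : ℝ) ^ 2 ≤ Q := by exact_mod_cast hwQ
  have hwq' : (w : ℝ) ^ 2 ≤ q := by
    refine le_trans (pow_le_pow_right₀ hw' (by norm_num : 2 ≤ 11)) ?_
    exact_mod_cast hwq
  have hcardT' : (#(decreasingPairs w P) : ℝ) ≤ (P : ℝ) ^ 2 := by exact_mod_cast hcardT
  have hlq : Real.log q ≤ Real.log N := Real.log_le_log hq' hqN'
  have hlq0 : 0 ≤ Real.log q := Real.log_natCast_nonneg q
  have hD4 : (1 : ℝ) ≤ (D : ℝ) ^ 4 := one_le_pow₀ hD1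
  refine sum_sum_le_of_sum_sq_le _ _ _
    (A := u * (P : ℝ) ^ 2 * Q + 16 * D ^ 4 * ((2 * u * (P : ℝ) ^ 2 * Q / q + 1) * (Q + q)))
    (by positivity) (hsq.trans ?_) ?_
  · push_cast
    have e1 : 6 * (Q : ℝ) + 2 * q * (1 + Real.log q) ≤ 8 * D * (Q + q) := by
      have h1 : (2 : ℝ) * q * (1 + Real.log q) ≤ 2 * q * D := by
        gcongr
        linarith
      have h2 : (Q : ℝ) ≤ D * Q := by nlinarith
      have h3 : (0 : ℝ) ≤ D * Q := by positivity
      have h4 : (0 : ℝ) ≤ D * q := by positivity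
      linarith
    have e2 : 2 * ((D : ℝ) * (D : ℝ) ^ 2 * (2 * u * (P : ℝ) ^ 2 * Q / q + 1) *
          (6 * Q + 2 * q * (1 + Real.log q))) ≤
        2 * ((D : ℝ) * (D : ℝ) ^ 2 * (2 * u * (P : ℝ) ^ 2 * Q / q + 1) * (8 * D * (Q + q))) := by
      gcongr
    have e3 : (u : ℝ) * #(decreasingPairs w P) * Q ≤ u * (P : ℝ) ^ 2 * Q := by gcongr
    refine (add_le_add e3 e2).trans (le_of_eq (by ring))
  · rw [Nat.card_Icc, Nat.add_sub_cancel, div_pow, le_div_iff₀ (by positivity)]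
    refine le_trans ?_ (typeII_parameter_bound hu' (zero_le_one.trans hP') hQ' hQN' hq' hqN' hwQ'
      hwq' hD4 hPQ')
    gcongr

lemma sum_norm_sum_bilinear_sq_le {w P Q M : ℕ} (hQ : 1 ≤ Q) {α : ℝ} {h : ℕ} (b : ℕ → ℂ)
    (hb : ∀ n, ‖b n‖ ≤ 1) (hP : M / Q ≤ P) :
    ∑ m ∈ Ico Q (2 * Q), ‖∑ n ∈ Ioc w (M / m),
        b n * e2pi (α * (h : ℝ) * ((m * n : ℕ) : ℝ) ^ 2)‖ ^ 2 ≤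
      Q * P + 2 * ∑ x ∈ decreasingPairs w P, ‖∑ m ∈ Ioc (Q - 1) (min (2 * Q - 1) (M / x.1)),
          e2pi (α * ((h * (x.1 ^ 2 - x.2 ^ 2) : ℕ) : ℝ) * (m : ℝ) ^ 2)‖ := by
  set z : ℕ → ℕ → ℂ := fun m n =>
    if n ≤ M / m then b n * e2pi (α * (h : ℝ) * ((m * n : ℕ) : ℝ) ^ 2) else 0 with hz
  have h1 : ∀ m ∈ Ico Q (2 * Q), ∑ n ∈ Ioc w (M / m),
      b n * e2pi (α * (h : ℝ) * ((m * n : ℕ) : ℝ) ^ 2) = ∑ n ∈ Ioc w P, z m n := by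
    intro m hm
    rw [mem_Ico] at hm
    have hmP : M / m ≤ P := (Nat.div_le_div_left hm.1 hQ).trans hP
    simp only [hz]
    rw [← sum_filter]
    refine sum_congr ?_ fun _ _ => rfl
    ext n
    simp only [mem_filter, mem_Ioc]
    omega
  have hz1 : ∀ m n, ‖z m n‖ ≤ 1 := by
    intro m n
    simp only [hz]
    split_ifs
    · rw [norm_mul, norm_e2pi, mul_one]
      exact hb n
    · simp
  rw [sum_congr rfl (fun m hm => by rw [h1 m hm, norm_sum_sq_eq]), sum_add_distrib, ← mul_sum]
  refine add_le_add ?_ (mul_le_mul_of_nonneg_left ?_ zero_le_two)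
  · calc ∑ m ∈ Ico Q (2 * Q), ∑ n ∈ Ioc w P, ‖z m n‖ ^ 2
        ≤ ∑ m ∈ Ico Q (2 * Q), ∑ n ∈ Ioc w P, (1 : ℝ) :=
          sum_le_sum fun m _ => sum_le_sum fun n _ => pow_le_one₀ (norm_nonneg _) (hz1 m n)
      _ ≤ Q * P := by
          simp only [sum_const, Nat.card_Ioc, Nat.card_Ico, nsmul_eq_mul, mul_one]
          rw [show 2 * Q - Q = Q by omega]
          gcongr
          exact Nat.sub_le _ _
  · rw [← Complex.re_sum]
    refine (Complex.re_le_norm _).trans ?_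
    have h2 : ∑ m ∈ Ico Q (2 * Q), ∑ n ∈ Ioc w P, ∑ n' ∈ Ioc w P with n' < n,
          z m n * (starRingEnd ℂ) (z m n') =
        ∑ x ∈ decreasingPairs w P, ∑ m ∈ Ico Q (2 * Q), z m x.1 * (starRingEnd ℂ) (z m x.2) := by
      rw [sum_comm (s := decreasingPairs w P)]
      refine sum_congr rfl fun m _ => ?_
      rw [decreasingPairs, sum_filter, sum_product]
      refine sum_congr rfl fun n _ => ?_
      rw [sum_filter]
    rw [h2]
    refine (norm_sum_le _ _).trans (sum_le_sum fun x hx => ?_)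
    simp only [decreasingPairs, mem_filter, mem_product, mem_Ioc] at hx
    have h3 : ∑ m ∈ Ico Q (2 * Q), z m x.1 * (starRingEnd ℂ) (z m x.2) =
        b x.1 * (starRingEnd ℂ) (b x.2) *
          ∑ m ∈ Ioc (Q - 1) (min (2 * Q - 1) (M / x.1)),
            e2pi (α * ((h * (x.1 ^ 2 - x.2 ^ 2) : ℕ) : ℝ) * (m : ℝ) ^ 2) := by
      have h4 : Ioc (Q - 1) (min (2 * Q - 1) (M / x.1)) =
          (Ico Q (2 * Q)).filter (fun m => x.1 ≤ M / m) := by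
        ext m
        simp only [mem_filter, mem_Ioc, mem_Ico, le_min_iff]
        constructor
        · rintro ⟨h5, h6, h7⟩
          rw [Nat.le_div_iff_mul_le (by omega)] at h7
          rw [Nat.le_div_iff_mul_le (by omega)]
          exact ⟨⟨by omega, by omega⟩, by linarith⟩
        · rintro ⟨⟨h5, h6⟩, h7⟩
          rw [Nat.le_div_iff_mul_le (by omega)] at h7
          rw [Nat.le_div_iff_mul_le (by omega)]
          exact ⟨by omega, by omega, by linarith⟩
      rw [h4, mul_sum, sum_filter]
      refine sum_congr rfl fun m _ => ?_
      simp only [hz]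
      by_cases h8 : x.1 ≤ M / m
      · rw [if_pos h8, if_pos (hx.2.le.trans h8), if_pos h8, map_mul, conj_e2pi]
        have h9 : x.2 ^ 2 ≤ x.1 ^ 2 := Nat.pow_le_pow_left hx.2.le 2
        rw [show α * ((h * (x.1 ^ 2 - x.2 ^ 2) : ℕ) : ℝ) * (m : ℝ) ^ 2 =
            α * (h : ℝ) * ((m * x.1 : ℕ) : ℝ) ^ 2 + -(α * (h : ℝ) * ((m * x.2 : ℕ) : ℝ) ^ 2) by
          push_cast [Nat.cast_sub h9]
          ring, e2pi_add]
        ring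
      · rw [if_neg h8, if_neg h8, zero_mul]
    rw [h3, norm_mul, norm_mul, RCLike.norm_conj]
    refine mul_le_of_le_one_left (norm_nonneg _) ?_
    exact mul_le_one₀ (hb _) (norm_nonneg _) (hb _)

lemma sum_norm_typeII_block_le {N q u D w Q : ℕ} (hw : 1 ≤ w) (hu : 1 ≤ u) (huN : u ≤ N)
    (hqN : q ≤ N) (hwq : w ^ 11 ≤ q) (hD : ∀ m, 1 ≤ m → m ≤ 2 * N ^ 4 → #m.divisors ≤ D)
    (hlog : 1 + Real.log N ≤ D)
    {α : ℝ} {a : ℤ} (hirr : Irrational α) (hcop : Int.gcd a q = 1)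
    (hα : |α - (a : ℝ) / (q : ℝ)| < 1 / (q : ℝ) ^ 2)
    (hwQ : w ^ 2 ≤ Q) (M : ℕ → ℕ) (hM : ∀ h, M h ≤ N) (c b : ℕ → ℂ)
    (hc : ∀ m ∈ Ico Q (2 * Q), ‖c m‖ ≤ D) (hb : ∀ n, ‖b n‖ ≤ 1) :
    ∑ h ∈ Icc 1 u, ‖∑ m ∈ Ico Q (2 * Q), c m * ∑ n ∈ Ioc w (M h / m),
        b n * e2pi (α * (h : ℝ) * ((m * n : ℕ) : ℝ) ^ 2)‖ ≤
      5 * D ^ 2 * u * N / √w := by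
  have hQ1 : 1 ≤ Q := le_trans (Nat.one_le_pow _ _ hw) hwQ
  rcases lt_or_ge N (w * Q) with hcase | hcase
  · refine le_trans (le_of_eq ?_) (by positivity : (0 : ℝ) ≤ _)
    refine sum_eq_zero fun h _ => ?_
    rw [sum_eq_zero, norm_zero]
    intro m hm
    rw [mem_Ico] at hm
    rw [Ioc_eq_empty, sum_empty, mul_zero]
    have : M h / m < w := by
      rw [Nat.div_lt_iff_lt_mul (by omega)]
      calc M h ≤ N := hM h
        _ < w * Q := hcase
        _ ≤ w * m := Nat.mul_le_mul_left _ hm.1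
    omega
  · set P := N / Q with hP
    have hwP : w ≤ P := (Nat.le_div_iff_mul_le (by omega)).2 hcase
    have hPQ : P * Q ≤ N := Nat.div_mul_le_self N Q
    have hpairs := sum_norm_typeII_pairs_le hw hu huN hqN hwq hD hlog hirr hcop hα hwQ
      (hw.trans hwP) hPQ M
    set W : ℕ → ℝ := fun h => ∑ x ∈ decreasingPairs w P,
        ‖∑ m ∈ Ioc (Q - 1) (min (2 * Q - 1) (M h / x.1)),
          e2pi (α * ((h * (x.1 ^ 2 - x.2 ^ 2) : ℕ) : ℝ) * (m : ℝ) ^ 2)‖ with hW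
    have hD1 : (1 : ℝ) ≤ D := by
      have := Real.log_natCast_nonneg N
      linarith
    have hw' : (1 : ℝ) ≤ w := by exact_mod_cast hw
    have hu' : (1 : ℝ) ≤ u := by exact_mod_cast hu
    have hQ' : (1 : ℝ) ≤ Q := by exact_mod_cast hQ1
    have hPQ' : (P : ℝ) * Q ≤ N := by exact_mod_cast hPQ
    have hcase' : (w : ℝ) * Q ≤ N := by exact_mod_cast hcase
    have hterm : ∀ h ∈ Icc 1 u, ‖∑ m ∈ Ico Q (2 * Q), c m * ∑ n ∈ Ioc w (M h / m),
        b n * e2pi (α * (h : ℝ) * ((m * n : ℕ) : ℝ) ^ 2)‖ ^ 2 ≤ D ^ 2 * Q * (Q * P + 2 * W h) := by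
      intro h _
      have h1 := sum_norm_sum_bilinear_sq_le (w := w) (P := P) (M := M h) hQ1 (α := α) (h := h) b hb
        (Nat.div_le_div_right (hM h))
      calc _ ≤ (∑ m ∈ Ico Q (2 * Q), ‖c m‖ * ‖∑ n ∈ Ioc w (M h / m),
            b n * e2pi (α * (h : ℝ) * ((m * n : ℕ) : ℝ) ^ 2)‖) ^ 2 := by
            gcongr
            refine (norm_sum_le _ _).trans (le_of_eq ?_)
            exact sum_congr rfl fun _ _ => norm_mul _ _
        _ ≤ (∑ m ∈ Ico Q (2 * Q), ‖c m‖ ^ 2) * ∑ m ∈ Ico Q (2 * Q), ‖∑ n ∈ Ioc w (M h / m),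
            b n * e2pi (α * (h : ℝ) * ((m * n : ℕ) : ℝ) ^ 2)‖ ^ 2 := sum_mul_sq_le_sq_mul_sq _ _ _
        _ ≤ (∑ m ∈ Ico Q (2 * Q), (D : ℝ) ^ 2) * (Q * P + 2 * W h) := by
            gcongr with m hm
            exact hc m hm
        _ = _ := by
            rw [sum_const, Nat.card_Ico, show 2 * Q - Q = Q by omega, nsmul_eq_mul]
            ring
    refine le_of_sq_le_sq ?_ (by positivity)
    calc _ ≤ (#(Icc 1 u) : ℝ) * ∑ h ∈ Icc 1 u, ‖∑ m ∈ Ico Q (2 * Q), c m *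
            ∑ n ∈ Ioc w (M h / m), b n * e2pi (α * (h : ℝ) * ((m * n : ℕ) : ℝ) ^ 2)‖ ^ 2 :=
          sq_sum_le_card_mul_sum_sq
      _ ≤ u * ∑ h ∈ Icc 1 u, (D : ℝ) ^ 2 * Q * (Q * P + 2 * W h) := by
          rw [Nat.card_Icc, Nat.add_sub_cancel]
          gcongr with h hh
          exact hterm h hh
      _ = u * (D ^ 2 * (Q * (u * (P * Q)) + 2 * (Q * ∑ h ∈ Icc 1 u, W h))) := by
          rw [← mul_sum, sum_add_distrib, ← mul_sum (Icc 1 u) W, sum_const, Nat.card_Icc, Nat.add_sub_cancel,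
            nsmul_eq_mul]
          ring
      _ ≤ u * (D ^ 2 * (N / w * (u * N) + 2 * (10 * D ^ 2 * u * N ^ 2 / w))) := by
          gcongr
          · rw [le_div_iff₀ (by positivity)]
            linarith
          · calc (Q : ℝ) * ∑ h ∈ Icc 1 u, W h ≤ Q * (10 * D ^ 2 * u * N ^ 2 / (w * Q)) := by gcongr
              _ = _ := by field_simp
      _ = u ^ 2 * N ^ 2 * (1 * D ^ 2 + 20 * D ^ 4) / w := by ring
      _ ≤ u ^ 2 * N ^ 2 * (D ^ 2 * D ^ 2 + 20 * D ^ 4) / w := by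
          gcongr
          exact one_le_pow₀ hD1
      _ ≤ u ^ 2 * N ^ 2 * (25 * D ^ 4) / w := by
          gcongr
          nlinarith [(by positivity : (0 : ℝ) ≤ (D : ℝ) ^ 4)]
      _ = _ := by
          rw [div_pow, Real.sq_sqrt (by positivity)]
          ring

lemma norm_sum_mul_le_of_norm_sum_le (v : ℕ → ℝ) (z : ℕ → ℂ) {T : ℝ} (K : ℕ)
    (hT : ∀ k ≤ K, ‖∑ n ∈ Ioc 0 k, z n‖ ≤ T) :
    ‖∑ n ∈ Ioc 0 K, (v n : ℂ) * z n‖ ≤ (|v K| + ∑ j ∈ range K, |v (j + 1) - v j|) * T := by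
  have key : ∑ n ∈ Ioc 0 K, (v n : ℂ) * z n = (v K : ℂ) * ∑ n ∈ Ioc 0 K, z n -
      ∑ j ∈ range K, ((v (j + 1) - v j : ℝ) : ℂ) * ∑ n ∈ Ioc 0 j, z n := by
    clear hT
    induction K with
    | zero => simp
    | succ K ih =>
      rw [sum_Ioc_succ_top (Nat.zero_le _), sum_Ioc_succ_top (Nat.zero_le _), ih, sum_range_succ]
      push_cast
      ring
  rw [key, add_mul, sum_mul]
  refine (norm_sub_le _ _).trans (add_le_add ?_ ((norm_sum_le _ _).trans ?_))
  · rw [norm_mul, Complex.norm_real, Real.norm_eq_abs]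
    gcongr
    exact hT K le_rfl
  · refine sum_le_sum fun j hj => ?_
    rw [norm_mul, Complex.norm_real, Real.norm_eq_abs]
    gcongr
    exact hT j (mem_range.1 hj).le

lemma exists_norm_sum_mul_le_of_monotone {v : ℕ → ℝ} (hv : Monotone v) (hv0 : 0 ≤ v 0)
    (z : ℕ → ℂ) {L : ℝ} (K : ℕ) (hL : v K ≤ L) :
    ∃ k ≤ K, ‖∑ n ∈ Ioc 0 K, (v n : ℂ) * z n‖ ≤ 2 * L * ‖∑ n ∈ Ioc 0 k, z n‖ := by
  obtain ⟨k, hk, hmax⟩ := exists_max_image (range (K + 1)) (fun k => ‖∑ n ∈ Ioc 0 k, z n‖)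
    ⟨0, by simp⟩
  refine ⟨k, Nat.lt_succ_iff.1 (mem_range.1 hk), ?_⟩
  refine (norm_sum_mul_le_of_norm_sum_le v z K fun j hj =>
    hmax j (mem_range.2 (Nat.lt_succ_of_le hj))).trans ?_
  gcongr
  have h1 : ∑ j ∈ range K, |v (j + 1) - v j| = v K - v 0 := by
    rw [← sum_range_sub]
    exact sum_congr rfl fun j _ => abs_of_nonneg (sub_nonneg.2 (hv (Nat.le_succ j)))
  rw [h1, abs_of_nonneg (hv0.trans (hv (Nat.zero_le K)))]
  linarith

lemma exists_norm_sum_mul_le_of_antitone {v : ℕ → ℝ} (hv : Antitone v) (hv0 : ∀ n, 0 ≤ v n)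
    (z : ℕ → ℂ) {L : ℝ} (K : ℕ) (hL : v 0 ≤ L) :
    ∃ k ≤ K, ‖∑ n ∈ Ioc 0 K, (v n : ℂ) * z n‖ ≤ L * ‖∑ n ∈ Ioc 0 k, z n‖ := by
  obtain ⟨k, hk, hmax⟩ := exists_max_image (range (K + 1)) (fun k => ‖∑ n ∈ Ioc 0 k, z n‖)
    ⟨0, by simp⟩
  refine ⟨k, Nat.lt_succ_iff.1 (mem_range.1 hk), ?_⟩
  refine (norm_sum_mul_le_of_norm_sum_le v z K fun j hj =>
    hmax j (mem_range.2 (Nat.lt_succ_of_le hj))).trans ?_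
  gcongr
  have h1 : ∑ j ∈ range K, |v (j + 1) - v j| = v 0 - v K := by
    rw [← sum_range_sub']
    refine sum_congr rfl fun j _ => ?_
    rw [abs_of_nonpos (sub_nonpos.2 (hv (Nat.le_succ j))), neg_sub]
  rw [h1, abs_of_nonneg (hv0 K)]
  linarith

section

open ArithmeticFunction
open scoped ArithmeticFunction.Moebius ArithmeticFunction.zeta

/-- The restriction of an arithmetic function to arguments at most `V`. -/
def truncLE (F : ArithmeticFunction ℝ) (V : ℕ) : ArithmeticFunction ℝ :=
  ⟨fun n => if n ≤ V then F n else 0, by simp⟩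

lemma truncLE_apply (F : ArithmeticFunction ℝ) (V n : ℕ) :
    truncLE F V n = if n ≤ V then F n else 0 := rfl

lemma sub_truncLE_apply (F : ArithmeticFunction ℝ) (V n : ℕ) :
    (F - truncLE F V) n = if n ≤ V then 0 else F n := by
  rw [sub_eq_add_neg, ArithmeticFunction.add_apply, ArithmeticFunction.neg_apply, truncLE_apply]
  split_ifs <;> simp

lemma vonMangoldt_eq_vaughan (U V : ℕ) :
    (vonMangoldt : ArithmeticFunction ℝ) = truncLE vonMangoldt V + truncLE (μ : ArithmeticFunction ℝ) U * log -
      (truncLE (μ : ArithmeticFunction ℝ) U * truncLE vonMangoldt V) * (ζ : ArithmeticFunction ℝ) +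
      ((vonMangoldt - truncLE vonMangoldt V) * (ζ : ArithmeticFunction ℝ)) *
        ((μ : ArithmeticFunction ℝ) - truncLE (μ : ArithmeticFunction ℝ) U) := by
  set L := truncLE vonMangoldt V
  set m := truncLE (μ : ArithmeticFunction ℝ) U
  have h1 : (ζ : ArithmeticFunction ℝ) * (μ : ArithmeticFunction ℝ) = 1 := coe_zeta_mul_coe_moebius
  have h2 : vonMangoldt * (ζ : ArithmeticFunction ℝ) = log := vonMangoldt_mul_zeta
  have h3 : ((vonMangoldt - L) * (ζ : ArithmeticFunction ℝ)) * ((μ : ArithmeticFunction ℝ) - m) =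
      (vonMangoldt - L) * ((ζ : ArithmeticFunction ℝ) * (μ : ArithmeticFunction ℝ)) -
        m * (vonMangoldt * (ζ : ArithmeticFunction ℝ)) + (m * L) * (ζ : ArithmeticFunction ℝ) := by ring
  rw [h3, h1, h2]
  ring

lemma sum_mul_apply_mul_eq (F G : ArithmeticFunction ℝ) (f : ℕ → ℂ) (M : ℕ) :
    ∑ n ∈ Ioc 0 M, ((F * G) n : ℂ) * f n =
      ∑ d ∈ Ioc 0 M, (F d : ℂ) * ∑ n ∈ Ioc 0 (M / d), (G n : ℂ) * f (d * n) := by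
  simp only [ArithmeticFunction.mul_apply, Complex.ofReal_sum, sum_mul, mul_sum]
  rw [sum_sigma', sum_sigma']
  refine sum_nbij' (fun x => ⟨x.2.1, x.2.2⟩) (fun x => ⟨x.1 * x.2, (x.1, x.2)⟩) ?_ ?_ ?_ ?_ ?_
  · rintro ⟨n, d, e⟩ h
    simp only [mem_sigma, mem_Ioc, Nat.mem_divisorsAntidiagonal] at h ⊢
    obtain ⟨⟨h1, h2⟩, rfl, h4⟩ := h
    have hd : 0 < d := Nat.pos_of_ne_zero (left_ne_zero_of_mul h4)
    have he : 0 < e := Nat.pos_of_ne_zero (right_ne_zero_of_mul h4)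
    refine ⟨⟨hd, (Nat.le_mul_of_pos_right d he).trans h2⟩, he, ?_⟩
    rw [Nat.le_div_iff_mul_le hd, mul_comm]
    exact h2
  · rintro ⟨d, e⟩ h
    simp only [mem_sigma, mem_Ioc, Nat.mem_divisorsAntidiagonal] at h ⊢
    obtain ⟨⟨h1, h2⟩, h3, h4⟩ := h
    rw [Nat.le_div_iff_mul_le h1, mul_comm] at h4
    have := Nat.mul_pos h1 h3
    exact ⟨⟨this, h4⟩, trivial, this.ne'⟩
  · rintro ⟨n, d, e⟩ h
    simp only [mem_sigma, mem_Ioc, Nat.mem_divisorsAntidiagonal] at h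
    obtain ⟨_, rfl, _⟩ := h
    rfl
  · rintro ⟨d, e⟩ h
    rfl
  · rintro ⟨n, d, e⟩ h
    simp only [mem_sigma, mem_Ioc, Nat.mem_divisorsAntidiagonal] at h
    obtain ⟨_, rfl, _⟩ := h
    push_cast
    ring

lemma sum_mul_apply_mul_eq_of_support (F G : ArithmeticFunction ℝ) (f : ℕ → ℂ) (M E : ℕ)
    (hF : ∀ d, E < d → F d = 0) :
    ∑ n ∈ Ioc 0 M, ((F * G) n : ℂ) * f n =
      ∑ d ∈ Icc 1 E, (F d : ℂ) * ∑ n ∈ Ioc 0 (M / d), (G n : ℂ) * f (d * n) := by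
  rw [sum_mul_apply_mul_eq]
  have h1 : ∑ d ∈ Ioc 0 M, (F d : ℂ) * ∑ n ∈ Ioc 0 (M / d), (G n : ℂ) * f (d * n) =
      ∑ d ∈ Ioc 0 (M + E), (F d : ℂ) * ∑ n ∈ Ioc 0 (M / d), (G n : ℂ) * f (d * n) := by
    refine sum_subset (Ioc_subset_Ioc le_rfl (by omega)) fun d hd hd' => ?_
    simp only [mem_Ioc] at hd hd'
    rw [Nat.div_eq_of_lt (by omega)]
    simp
  rw [h1]
  symm
  refine sum_subset (fun d hd => ?_) fun d hd hd' => ?_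
  · simp only [mem_Icc, mem_Ioc] at hd ⊢
    omega
  · simp only [mem_Icc, mem_Ioc] at hd hd'
    rw [hF d (by omega)]
    simp

lemma abs_truncLE_moebius_mul_truncLE_vonMangoldt_le (U V d : ℕ) :
    |(truncLE (μ : ArithmeticFunction ℝ) U * truncLE vonMangoldt V) d| ≤ Real.log d := by
  rw [← vonMangoldt_sum, ArithmeticFunction.mul_apply]
  refine (abs_sum_le_sum_abs _ _).trans ?_
  rw [← Nat.sum_divisorsAntidiagonal' (f := fun _ e => vonMangoldt e)]
  refine sum_le_sum fun x _ => ?_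
  rw [abs_mul, truncLE_apply, truncLE_apply]
  have h1 : |(if x.1 ≤ U then (μ : ArithmeticFunction ℝ) x.1 else 0)| ≤ 1 := by
    split_ifs
    · rw [intCoe_apply]
      exact_mod_cast abs_moebius_le_one
    · simp
  have h2 : |(if x.2 ≤ V then vonMangoldt x.2 else 0)| ≤ vonMangoldt x.2 := by
    split_ifs
    · rw [abs_of_nonneg vonMangoldt_nonneg]
    · simp [vonMangoldt_nonneg]
  calc _ ≤ 1 * vonMangoldt x.2 := by gcongr
    _ = _ := one_mul _

lemma truncLE_mul_truncLE_apply_eq_zero (F G : ArithmeticFunction ℝ) {U V d : ℕ} (h : U * V < d) :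
    (truncLE F U * truncLE G V) d = 0 := by
  rw [ArithmeticFunction.mul_apply]
  refine sum_eq_zero fun x hx => ?_
  rw [Nat.mem_divisorsAntidiagonal] at hx
  rw [truncLE_apply, truncLE_apply]
  by_cases h1 : x.1 ≤ U
  · by_cases h2 : x.2 ≤ V
    · have := Nat.mul_le_mul h1 h2
      omega
    · rw [if_neg h2, mul_zero]
  · rw [if_neg h1, zero_mul]

lemma sub_truncLE_vonMangoldt_mul_zeta_apply (V m : ℕ) :
    ((vonMangoldt - truncLE vonMangoldt V) * (ζ : ArithmeticFunction ℝ)) m =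
      ∑ d ∈ m.divisors, if d ≤ V then 0 else vonMangoldt d := by
  rw [coe_mul_zeta_apply]
  exact sum_congr rfl fun d _ => sub_truncLE_apply _ _ _

lemma abs_sub_truncLE_vonMangoldt_mul_zeta_le (V m : ℕ) :
    |((vonMangoldt - truncLE vonMangoldt V) * (ζ : ArithmeticFunction ℝ)) m| ≤ Real.log m := by
  rw [sub_truncLE_vonMangoldt_mul_zeta_apply, ← vonMangoldt_sum, abs_of_nonneg]
  · refine sum_le_sum fun d _ => ?_
    split_ifs
    · exact vonMangoldt_nonneg
    · exact le_rfl
  · refine sum_nonneg fun d _ => ?_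
    split_ifs
    · exact le_rfl
    · exact vonMangoldt_nonneg

lemma sub_truncLE_vonMangoldt_mul_zeta_eq_zero {V m : ℕ} (h : m ≤ V) :
    ((vonMangoldt - truncLE vonMangoldt V) * (ζ : ArithmeticFunction ℝ)) m = 0 := by
  rw [sub_truncLE_vonMangoldt_mul_zeta_apply]
  exact sum_eq_zero fun d hd => if_pos ((Nat.divisor_le hd).trans h)

lemma log_natCast_le_of_le {N D m : ℕ} (hlog : 1 + Real.log N ≤ D) (hm : m ≤ N) :
    Real.log m ≤ D := by
  rcases Nat.eq_zero_or_pos m with rfl | h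
  · simp
  · have : Real.log m ≤ Real.log N := Real.log_le_log (by exact_mod_cast h) (by exact_mod_cast hm)
    linarith

lemma sum_norm_moebius_mul_log_le {N q u D w : ℕ} (hw : 1 ≤ w) (hu : 1 ≤ u) (huN : u ≤ N)
    (hqN : q ≤ N) (hwq : w ^ 11 ≤ q) (hD : ∀ m, 1 ≤ m → m ≤ 2 * N ^ 4 → #m.divisors ≤ D)
    (hlog : 1 + Real.log N ≤ D) {α : ℝ} {a : ℤ} (hirr : Irrational α) (hcop : Int.gcd a q = 1)
    (hα : |α - (a : ℝ) / (q : ℝ)| < 1 / (q : ℝ) ^ 2) (M : ℕ → ℕ) (hM : ∀ h, M h ≤ N) :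
    ∑ h ∈ Icc 1 u, ‖∑ n ∈ Ioc 0 (M h), ((truncLE (μ : ArithmeticFunction ℝ) w * log) n : ℂ) *
      e2pi (α * (h : ℝ) * (n : ℝ) ^ 2)‖ ≤ 14 * (D : ℝ) ^ 3 * u * N / w := by
  have hex : ∀ h d : ℕ, ∃ k ≤ M h / d, ‖∑ n ∈ Ioc 0 (M h / d), ((log n : ℝ) : ℂ) *
      e2pi (α * (h : ℝ) * ((d * n : ℕ) : ℝ) ^ 2)‖ ≤
        2 * D * ‖∑ n ∈ Ioc 0 k, e2pi (α * (h : ℝ) * ((d * n : ℕ) : ℝ) ^ 2)‖ := by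
    intro h d
    have hmono : Monotone fun n : ℕ => Real.log n := by
      intro m n hmn
      rcases Nat.eq_zero_or_pos m with rfl | hm
      · simpa using Real.log_natCast_nonneg n
      · exact Real.log_le_log (by exact_mod_cast hm) (by exact_mod_cast hmn)
    exact exists_norm_sum_mul_le_of_monotone hmono (by simp)
      (fun n => e2pi (α * (h : ℝ) * ((d * n : ℕ) : ℝ) ^ 2)) (M h / d)
      (log_natCast_le_of_le hlog ((Nat.div_le_self _ _).trans (hM h)))
  choose k hk hkb using hex
  have hI := sum_norm_typeI_le hw hu huN hqN hwq hD hlog hirr hcop hα k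
    (fun h d => (hk h d).trans ((Nat.div_le_self _ _).trans (hM h)))
  have hw3 : w ≤ w ^ 3 := Nat.le_self_pow (by norm_num) w
  calc _ ≤ ∑ h ∈ Icc 1 u, 2 * (D : ℝ) * ∑ d ∈ Icc 1 (w ^ 3),
        ‖∑ n ∈ Ioc 0 (k h d), e2pi (α * (h : ℝ) * ((d * n : ℕ) : ℝ) ^ 2)‖ := by
        refine sum_le_sum fun h _ => ?_
        rw [sum_mul_apply_mul_eq_of_support _ _ _ _ w (fun d hd => by
          rw [truncLE_apply, if_neg (by omega)]), mul_sum]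
        refine (norm_sum_le _ _).trans ((sum_le_sum fun d _ => ?_).trans
          (sum_le_sum_of_subset_of_nonneg (Icc_subset_Icc le_rfl hw3) fun _ _ _ => by positivity))
        rw [norm_mul, Complex.norm_real, Real.norm_eq_abs]
        have h1 : |truncLE (μ : ArithmeticFunction ℝ) w d| ≤ 1 := by
          rw [truncLE_apply]
          split_ifs
          · rw [intCoe_apply]
            exact_mod_cast abs_moebius_le_one
          · simp
        calc _ ≤ 1 * ‖∑ n ∈ Ioc 0 (M h / d), ((log n : ℝ) : ℂ) *
              e2pi (α * (h : ℝ) * ((d * n : ℕ) : ℝ) ^ 2)‖ := by gcongr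
          _ ≤ _ := by rw [one_mul]; exact hkb h d
    _ = 2 * (D : ℝ) * ∑ h ∈ Icc 1 u, ∑ d ∈ Icc 1 (w ^ 3),
        ‖∑ n ∈ Ioc 0 (k h d), e2pi (α * (h : ℝ) * ((d * n : ℕ) : ℝ) ^ 2)‖ := by rw [mul_sum]
    _ ≤ 2 * (D : ℝ) * (7 * (D : ℝ) ^ 2 * u * N / w) := by gcongr
    _ = _ := by ring

lemma sum_norm_moebius_mul_vonMangoldt_mul_zeta_le {N q u D w : ℕ} (hw : 1 ≤ w) (hu : 1 ≤ u)
    (huN : u ≤ N) (hqN : q ≤ N) (hwq : w ^ 11 ≤ q)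
    (hD : ∀ m, 1 ≤ m → m ≤ 2 * N ^ 4 → #m.divisors ≤ D)
    (hlog : 1 + Real.log N ≤ D) {α : ℝ} {a : ℤ} (hirr : Irrational α) (hcop : Int.gcd a q = 1)
    (hα : |α - (a : ℝ) / (q : ℝ)| < 1 / (q : ℝ) ^ 2) (M : ℕ → ℕ) (hM : ∀ h, M h ≤ N) :
    ∑ h ∈ Icc 1 u, ‖∑ n ∈ Ioc 0 (M h), (((truncLE (μ : ArithmeticFunction ℝ) w *
      truncLE vonMangoldt (w ^ 2)) * (ζ : ArithmeticFunction ℝ)) n : ℂ) *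
        e2pi (α * (h : ℝ) * (n : ℝ) ^ 2)‖ ≤ 7 * (D : ℝ) ^ 3 * u * N / w := by
  have hI := sum_norm_typeI_le hw hu huN hqN hwq hD hlog hirr hcop hα (fun h d => M h / d)
    (fun h d => (Nat.div_le_self _ _).trans (hM h))
  have hw3 : w ^ 3 ≤ N := (Nat.pow_le_pow_right hw (by norm_num)).trans (hwq.trans hqN)
  calc _ ≤ ∑ h ∈ Icc 1 u, (D : ℝ) * ∑ d ∈ Icc 1 (w ^ 3),
        ‖∑ n ∈ Ioc 0 (M h / d), e2pi (α * (h : ℝ) * ((d * n : ℕ) : ℝ) ^ 2)‖ := by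
        refine sum_le_sum fun h _ => ?_
        rw [sum_mul_apply_mul_eq_of_support _ _ _ _ (w ^ 3) (fun d hd =>
          truncLE_mul_truncLE_apply_eq_zero _ _ (by rwa [← pow_succ'])), mul_sum]
        refine (norm_sum_le _ _).trans (sum_le_sum fun d hd => ?_)
        rw [norm_mul, Complex.norm_real, Real.norm_eq_abs]
        have h1 := (abs_truncLE_moebius_mul_truncLE_vonMangoldt_le w (w ^ 2) d).trans
          (log_natCast_le_of_le hlog ((mem_Icc.1 hd).2.trans hw3))
        have h2 : ∑ n ∈ Ioc 0 (M h / d), (((ζ : ArithmeticFunction ℝ) n : ℝ) : ℂ) *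
            e2pi (α * (h : ℝ) * ((d * n : ℕ) : ℝ) ^ 2) =
              ∑ n ∈ Ioc 0 (M h / d), e2pi (α * (h : ℝ) * ((d * n : ℕ) : ℝ) ^ 2) := by
          refine sum_congr rfl fun n hn => ?_
          have : n ≠ 0 := by have := (mem_Ioc.1 hn).1; omega
          rw [natCoe_apply, zeta_apply_ne this]
          simp
        rw [h2]
        gcongr
    _ = (D : ℝ) * ∑ h ∈ Icc 1 u, ∑ d ∈ Icc 1 (w ^ 3),
        ‖∑ n ∈ Ioc 0 (M h / d), e2pi (α * (h : ℝ) * ((d * n : ℕ) : ℝ) ^ 2)‖ := by rw [mul_sum]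
    _ ≤ (D : ℝ) * (7 * (D : ℝ) ^ 2 * u * N / w) := by gcongr
    _ = _ := by ring

lemma sum_Ico_mul_two_pow (g : ℕ → ℂ) (V K : ℕ) :
    ∑ m ∈ Ico V (V * 2 ^ K), g m =
      ∑ j ∈ range K, ∑ m ∈ Ico (V * 2 ^ j) (2 * (V * 2 ^ j)), g m := by
  induction K with
  | zero => simp
  | succ K ih =>
    rw [sum_range_succ, ← ih, pow_succ, show V * (2 ^ K * 2) = 2 * (V * 2 ^ K) by ring,
      sum_Ico_consecutive]
    · exact Nat.le_mul_of_pos_right V (by positivity)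
    · omega

lemma natCast_log_two_succ_le {N D : ℕ} (hN : 1 ≤ N) (hlog : 1 + Real.log N ≤ D) :
    ((Nat.log 2 N + 1 : ℕ) : ℝ) ≤ 2 * D := by
  have h1 : (2 : ℝ) ^ Nat.log 2 N ≤ N := by
    exact_mod_cast Nat.pow_log_le_self 2 (by omega : N ≠ 0)
  have h2 := Real.log_le_log (by positivity) h1
  rw [Real.log_pow] at h2
  have h3 := Real.log_two_gt_d9
  have h4 : (0 : ℝ) ≤ Nat.log 2 N := Nat.cast_nonneg _
  push_cast
  nlinarith

lemma sum_norm_typeII_le {N q u D w : ℕ} (hw : 1 ≤ w) (hu : 1 ≤ u)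
    (huN : u ≤ N) (hqN : q ≤ N) (hwq : w ^ 11 ≤ q)
    (hD : ∀ m, 1 ≤ m → m ≤ 2 * N ^ 4 → #m.divisors ≤ D)
    (hlog : 1 + Real.log N ≤ D) {α : ℝ} {a : ℤ} (hirr : Irrational α) (hcop : Int.gcd a q = 1)
    (hα : |α - (a : ℝ) / (q : ℝ)| < 1 / (q : ℝ) ^ 2) (M : ℕ → ℕ) (hM : ∀ h, M h ≤ N) :
    ∑ h ∈ Icc 1 u, ‖∑ n ∈ Ioc 0 (M h),
      ((((vonMangoldt - truncLE vonMangoldt (w ^ 2)) * (ζ : ArithmeticFunction ℝ)) *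
        ((μ : ArithmeticFunction ℝ) - truncLE (μ : ArithmeticFunction ℝ) w)) n : ℂ) *
        e2pi (α * (h : ℝ) * (n : ℝ) ^ 2)‖ ≤ 10 * (D : ℝ) ^ 3 * u * N / √w := by
  set F := (vonMangoldt - truncLE vonMangoldt (w ^ 2)) * (ζ : ArithmeticFunction ℝ) with hF
  set G := (μ : ArithmeticFunction ℝ) - truncLE (μ : ArithmeticFunction ℝ) w with hG
  set K := Nat.log 2 N + 1 with hK
  have hN : 1 ≤ N := hu.trans huN
  have hNK : N < 2 ^ K := Nat.lt_pow_succ_log_self (by norm_num) N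
  set c : ℕ → ℂ := fun m => if m ≤ N then (F m : ℂ) else 0 with hc
  have hcD : ∀ m, ‖c m‖ ≤ D := by
    intro m
    simp only [hc]
    split_ifs with h
    · rw [Complex.norm_real, Real.norm_eq_abs]
      exact (abs_sub_truncLE_vonMangoldt_mul_zeta_le _ _).trans (log_natCast_le_of_le hlog h)
    · simp
  have hG1 : ∀ n, ‖(G n : ℂ)‖ ≤ 1 := by
    intro n
    rw [Complex.norm_real, Real.norm_eq_abs, hG, sub_truncLE_apply]
    split_ifs
    · simp
    · rw [intCoe_apply]
      exact_mod_cast abs_moebius_le_one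
  have hbl : ∀ j : ℕ, _ := fun j => sum_norm_typeII_block_le (Q := w ^ 2 * 2 ^ j) hw hu huN hqN hwq
    hD hlog hirr hcop hα (Nat.le_mul_of_pos_right _ (by positivity)) M hM c (fun n => (G n : ℂ))
    (fun m _ => hcD m) hG1
  have hrw : ∀ h, ∑ n ∈ Ioc 0 (M h), ((F * G) n : ℂ) * e2pi (α * (h : ℝ) * (n : ℝ) ^ 2) =
      ∑ j ∈ range K, ∑ m ∈ Ico (w ^ 2 * 2 ^ j) (2 * (w ^ 2 * 2 ^ j)), c m *
        ∑ n ∈ Ioc w (M h / m), (G n : ℂ) * e2pi (α * (h : ℝ) * ((m * n : ℕ) : ℝ) ^ 2) := by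
    intro h
    rw [← sum_Ico_mul_two_pow, sum_mul_apply_mul_eq]
    have hin : ∀ m, ∑ n ∈ Ioc 0 (M h / m), (G n : ℂ) *
        e2pi (α * (h : ℝ) * ((m * n : ℕ) : ℝ) ^ 2) =
          ∑ n ∈ Ioc w (M h / m), (G n : ℂ) * e2pi (α * (h : ℝ) * ((m * n : ℕ) : ℝ) ^ 2) := by
      intro m
      symm
      refine sum_subset (Ioc_subset_Ioc (Nat.zero_le _) le_rfl) fun n hn hn' => ?_
      simp only [mem_Ioc] at hn hn'
      rw [hG, sub_truncLE_apply, if_pos (by omega)]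
      simp
    have hout : ∀ m ∈ Ioc 0 (M h), (F m : ℂ) = c m := by
      intro m hm
      simp only [hc]
      rw [if_pos ((mem_Ioc.1 hm).2.trans (hM h))]
    rw [sum_congr rfl fun m hm => by rw [hin m, hout m hm]]
    have hwK : N < w ^ 2 * 2 ^ K := hNK.trans_le (Nat.le_mul_of_pos_left _ (by positivity))
    have e1 : ∀ s : Finset ℕ, s ⊆ range (w ^ 2 * 2 ^ K) → (∀ m, w ^ 2 < m → m ≤ M h → m ∈ s) →
        ∑ m ∈ s, c m *
          ∑ n ∈ Ioc w (M h / m), (G n : ℂ) * e2pi (α * (h : ℝ) * ((m * n : ℕ) : ℝ) ^ 2) =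
        ∑ m ∈ range (w ^ 2 * 2 ^ K), c m *
          ∑ n ∈ Ioc w (M h / m), (G n : ℂ) * e2pi (α * (h : ℝ) * ((m * n : ℕ) : ℝ) ^ 2) := by
      intro s hs hs'
      refine sum_subset hs fun m _ hm => ?_
      by_cases h1 : m ≤ w ^ 2
      · have : c m = 0 := by
          simp only [hc]
          rw [hF, sub_truncLE_vonMangoldt_mul_zeta_eq_zero h1]
          simp
        rw [this, zero_mul]
      · have h2 : M h < m := by
          by_contra h2
          exact hm (hs' m (by omega) (by omega))
        rw [Nat.div_eq_of_lt h2]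
        simp
    refine (e1 (Ioc 0 (M h)) (fun m hm => ?_) fun m h1 h2 => ?_).trans
      (e1 (Ico (w ^ 2) (w ^ 2 * 2 ^ K)) (fun m hm => ?_) fun m h1 h2 => ?_).symm
    · exact mem_range.2 (((mem_Ioc.1 hm).2.trans (hM h)).trans_lt hwK)
    · exact mem_Ioc.2 ⟨by omega, h2⟩
    · exact mem_range.2 (mem_Ico.1 hm).2
    · exact mem_Ico.2 ⟨h1.le, (h2.trans (hM h)).trans_lt hwK⟩
  have hKD : (K : ℝ) ≤ 2 * D := natCast_log_two_succ_le hN hlog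
  calc _ ≤ ∑ h ∈ Icc 1 u, ∑ j ∈ range K, ‖∑ m ∈ Ico (w ^ 2 * 2 ^ j) (2 * (w ^ 2 * 2 ^ j)), c m *
        ∑ n ∈ Ioc w (M h / m), (G n : ℂ) * e2pi (α * (h : ℝ) * ((m * n : ℕ) : ℝ) ^ 2)‖ := by
        refine sum_le_sum fun h _ => ?_
        rw [hrw]
        exact norm_sum_le _ _
    _ ≤ ∑ j ∈ range K, 5 * (D : ℝ) ^ 2 * u * N / √w := by
        rw [sum_comm]
        exact sum_le_sum fun j _ => hbl j
    _ = K * (5 * (D : ℝ) ^ 2 * u * N / √w) := by simp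
    _ ≤ 2 * D * (5 * (D : ℝ) ^ 2 * u * N / √w) := by gcongr
    _ = _ := by ring

lemma norm_sum_truncLE_vonMangoldt_le {V D N : ℕ} (hlog : 1 + Real.log N ≤ D) (hV : V ≤ N)
    (M : ℕ) (f : ℕ → ℂ) (hf : ∀ n, ‖f n‖ ≤ 1) :
    ‖∑ n ∈ Ioc 0 M, (truncLE vonMangoldt V n : ℂ) * f n‖ ≤ V * D := by
  have h1 : ∑ n ∈ Ioc 0 M, (truncLE vonMangoldt V n : ℂ) * f n =
      ∑ n ∈ Ioc 0 M with n ≤ V, (truncLE vonMangoldt V n : ℂ) * f n := by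
    rw [sum_filter]
    refine sum_congr rfl fun n _ => ?_
    rw [truncLE_apply]
    split_ifs <;> simp
  have h2 : #{n ∈ Ioc 0 M | n ≤ V} ≤ V := by
    calc _ ≤ #(Ioc 0 V) := card_le_card fun n hn => by
          simp only [mem_filter, mem_Ioc] at hn ⊢
          omega
      _ = V := by simp
  rw [h1]
  refine (norm_sum_le_of_le (n := fun _ => (D : ℝ)) _ fun n hn => ?_).trans ?_
  · have hnV := (mem_filter.1 hn).2
    rw [norm_mul, Complex.norm_real, truncLE_apply, if_pos hnV, Real.norm_eq_abs,
      abs_of_nonneg vonMangoldt_nonneg]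
    calc _ ≤ (D : ℝ) * 1 := by
          gcongr
          · exact vonMangoldt_le_log.trans (log_natCast_le_of_le hlog (hnV.trans hV))
          · exact hf n
      _ = _ := mul_one _
  · rw [sum_const, nsmul_eq_mul]
    gcongr

lemma sum_norm_vonMangoldt_le {N q u D w : ℕ} (hw : 1 ≤ w) (hu : 1 ≤ u)
    (huN : u ≤ N) (hqN : q ≤ N) (hwq : w ^ 11 ≤ q)
    (hD : ∀ m, 1 ≤ m → m ≤ 2 * N ^ 4 → #m.divisors ≤ D)
    (hlog : 1 + Real.log N ≤ D) {α : ℝ} {a : ℤ} (hirr : Irrational α) (hcop : Int.gcd a q = 1)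
    (hα : |α - (a : ℝ) / (q : ℝ)| < 1 / (q : ℝ) ^ 2) (M : ℕ → ℕ) (hM : ∀ h, M h ≤ N) :
    ∑ h ∈ Icc 1 u, ‖∑ n ∈ Ioc 0 (M h), (vonMangoldt n : ℂ) * e2pi (α * (h : ℝ) * (n : ℝ) ^ 2)‖ ≤
      32 * (D : ℝ) ^ 3 * u * N / √w := by
  have h2 := sum_norm_moebius_mul_log_le hw hu huN hqN hwq hD hlog hirr hcop hα M hM
  have h3 := sum_norm_moebius_mul_vonMangoldt_mul_zeta_le hw hu huN hqN hwq hD hlog hirr hcop hα M hM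
  have h4 := sum_norm_typeII_le hw hu huN hqN hwq hD hlog hirr hcop hα M hM
  have hw3 : w ^ 3 ≤ N := (Nat.pow_le_pow_right hw (by norm_num)).trans (hwq.trans hqN)
  have hw2 : w ^ 2 ≤ N := (Nat.pow_le_pow_right hw (by norm_num)).trans hw3
  have h1 : ∑ h ∈ Icc 1 u, ‖∑ n ∈ Ioc 0 (M h), (truncLE vonMangoldt (w ^ 2) n : ℂ) *
      e2pi (α * (h : ℝ) * (n : ℝ) ^ 2)‖ ≤ u * ((w : ℝ) ^ 2 * D) := by
    refine (sum_le_card_nsmul _ _ ((w : ℝ) ^ 2 * D) fun h _ => ?_).trans_eq (by simp)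
    exact_mod_cast norm_sum_truncLE_vonMangoldt_le hlog hw2 (M h) _ fun n => (norm_e2pi _).le
  have hw1 : (1 : ℝ) ≤ w := by exact_mod_cast hw
  have hs1 : 1 ≤ √(w : ℝ) := Real.one_le_sqrt.2 hw1
  have hs2 : √(w : ℝ) ≤ w := by nlinarith [Real.sq_sqrt (show (0 : ℝ) ≤ w by positivity)]
  have hD1 : (1 : ℝ) ≤ D := by linarith [Real.log_natCast_nonneg N]
  have hwN : (w : ℝ) ^ 3 ≤ N := by exact_mod_cast hw3
  have b1 : (u : ℝ) * ((w : ℝ) ^ 2 * D) ≤ (D : ℝ) ^ 3 * u * N / √w := by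
    rw [le_div_iff₀ (by positivity)]
    calc (u : ℝ) * ((w : ℝ) ^ 2 * D) * √w ≤ u * ((w : ℝ) ^ 2 * D) * w := by gcongr
      _ = D * u * (w : ℝ) ^ 3 := by ring
      _ ≤ (D : ℝ) ^ 3 * u * N := by
        gcongr
        exact le_self_pow₀ hD1 (by norm_num)
  have b2 : 14 * (D : ℝ) ^ 3 * u * N / w ≤ 14 * (D : ℝ) ^ 3 * u * N / √w := by gcongr
  have b3 : 7 * (D : ℝ) ^ 3 * u * N / w ≤ 7 * (D : ℝ) ^ 3 * u * N / √w := by gcongr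
  have htri : ∀ h : ℕ, ‖∑ n ∈ Ioc 0 (M h), (vonMangoldt n : ℂ) *
      e2pi (α * (h : ℝ) * (n : ℝ) ^ 2)‖ ≤
      ‖∑ n ∈ Ioc 0 (M h), (truncLE vonMangoldt (w ^ 2) n : ℂ) *
        e2pi (α * (h : ℝ) * (n : ℝ) ^ 2)‖ +
      ‖∑ n ∈ Ioc 0 (M h), ((truncLE (μ : ArithmeticFunction ℝ) w * log) n : ℂ) *
        e2pi (α * (h : ℝ) * (n : ℝ) ^ 2)‖ +
      ‖∑ n ∈ Ioc 0 (M h), (((truncLE (μ : ArithmeticFunction ℝ) w *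
        truncLE vonMangoldt (w ^ 2)) * (ζ : ArithmeticFunction ℝ)) n : ℂ) *
        e2pi (α * (h : ℝ) * (n : ℝ) ^ 2)‖ +
      ‖∑ n ∈ Ioc 0 (M h),
        ((((vonMangoldt - truncLE vonMangoldt (w ^ 2)) * (ζ : ArithmeticFunction ℝ)) *
        ((μ : ArithmeticFunction ℝ) - truncLE (μ : ArithmeticFunction ℝ) w)) n : ℂ) *
        e2pi (α * (h : ℝ) * (n : ℝ) ^ 2)‖ := by
    intro h
    have : ∀ n : ℕ, (vonMangoldt n : ℂ) = (truncLE vonMangoldt (w ^ 2) n : ℂ) +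
        ((truncLE (μ : ArithmeticFunction ℝ) w * log) n : ℂ) -
        (((truncLE (μ : ArithmeticFunction ℝ) w *
          truncLE vonMangoldt (w ^ 2)) * (ζ : ArithmeticFunction ℝ)) n : ℂ) +
        ((((vonMangoldt - truncLE vonMangoldt (w ^ 2)) * (ζ : ArithmeticFunction ℝ)) *
        ((μ : ArithmeticFunction ℝ) - truncLE (μ : ArithmeticFunction ℝ) w)) n : ℂ) := by
      intro n
      have := congrArg (fun A : ArithmeticFunction ℝ => A n) (vonMangoldt_eq_vaughan w (w ^ 2))
      simp only [ArithmeticFunction.add_apply, sub_eq_add_neg, ArithmeticFunction.neg_apply] at this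
      simp only [sub_eq_add_neg]
      exact_mod_cast this
    rw [sum_congr rfl fun n _ => by rw [this n]]
    simp only [add_mul, sub_mul, sum_add_distrib, sum_sub_distrib]
    refine (norm_add_le _ _).trans (add_le_add ?_ le_rfl)
    refine (norm_sub_le _ _).trans (add_le_add ?_ le_rfl)
    exact norm_add_le _ _
  calc _ ≤ _ := sum_le_sum fun h _ => htri h
    _ ≤ (D : ℝ) ^ 3 * u * N / √w + 14 * (D : ℝ) ^ 3 * u * N / √w + 7 * (D : ℝ) ^ 3 * u * N / √w +
        10 * (D : ℝ) ^ 3 * u * N / √w := by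
        rw [sum_add_distrib, sum_add_distrib, sum_add_distrib]
        linarith
    _ = _ := by ring

end

lemma succ_le_mul_rpow_mul {δ : ℝ} (hδ : 0 < δ) {p : ℕ} (hp : 2 ≤ p) (k : ℕ) :
    (k : ℝ) + 1 ≤ max 1 (1 / (δ * Real.log 2)) * ((p : ℝ) ^ k) ^ δ := by
  have hl : 0 < δ * Real.log 2 := mul_pos hδ (Real.log_pos one_lt_two)
  have h1 : 1 + k * (δ * Real.log 2) ≤ ((p : ℝ) ^ k) ^ δ := by
    calc 1 + k * (δ * Real.log 2) ≤ Real.exp (k * (δ * Real.log 2)) := by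
          rw [add_comm]; exact Real.add_one_le_exp _
      _ = ((2 : ℝ) ^ k) ^ δ := by
          rw [Real.rpow_def_of_pos (by positivity), Real.log_pow]
          ring_nf
      _ ≤ _ := by
          gcongr
          exact_mod_cast hp
  calc (k : ℝ) + 1 = 1 * 1 + 1 / (δ * Real.log 2) * (k * (δ * Real.log 2)) := by
        field_simp
        ring
    _ ≤ max 1 (1 / (δ * Real.log 2)) * 1 +
        max 1 (1 / (δ * Real.log 2)) * (k * (δ * Real.log 2)) := by
        gcongr
        · exact le_max_left _ _
        · exact le_max_right _ _
    _ = max 1 (1 / (δ * Real.log 2)) * (1 + k * (δ * Real.log 2)) := by ring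
    _ ≤ _ := by gcongr

lemma succ_le_rpow_of_two_le_rpow {δ : ℝ} {p : ℕ} (hp : 2 ≤ (p : ℝ) ^ δ) (k : ℕ) :
    (k : ℝ) + 1 ≤ ((p : ℝ) ^ k) ^ δ := by
  rw [← Real.rpow_natCast, ← Real.rpow_mul (by positivity), mul_comm,
    Real.rpow_mul (by positivity), Real.rpow_natCast]
  calc (k : ℝ) + 1 ≤ 2 ^ k := by exact_mod_cast Nat.lt_two_pow_self
    _ ≤ _ := by gcongr

/-- The divisor bound. -/
lemma exists_card_divisors_le_mul_rpow {δ : ℝ} (hδ : 0 < δ) :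
    ∃ C : ℝ, 1 ≤ C ∧ ∀ n : ℕ, 1 ≤ n → (#n.divisors : ℝ) ≤ C * (n : ℝ) ^ δ := by
  set K := max 1 (1 / (δ * Real.log 2)) with hK
  have hK1 : 1 ≤ K := le_max_left _ _
  set B := ⌈(2 : ℝ) ^ (1 / δ)⌉₊ with hB
  refine ⟨K ^ B, one_le_pow₀ hK1, fun n hn => ?_⟩
  have hlarge : ∀ p : ℕ, B ≤ p → 2 ≤ (p : ℝ) ^ δ := by
    intro p hp
    have h1 : (2 : ℝ) ^ (1 / δ) ≤ p := (Nat.le_ceil _).trans (by exact_mod_cast hp)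
    calc (2 : ℝ) = ((2 : ℝ) ^ (1 / δ)) ^ δ := by
          rw [← Real.rpow_mul (by norm_num), one_div_mul_cancel hδ.ne', Real.rpow_one]
      _ ≤ _ := by gcongr
  have hprod : (n : ℝ) ^ δ = ∏ p ∈ n.primeFactors, ((p : ℝ) ^ n.factorization p) ^ δ := by
    rw [Real.finsetProd_rpow _ _ fun _ _ => by positivity]
    congr 1
    exact_mod_cast (Nat.prod_factorization_pow_eq_self (by omega : n ≠ 0)).symm
  rw [Nat.card_divisors (by omega), hprod]
  push_cast
  calc ∏ p ∈ n.primeFactors, ((n.factorization p : ℝ) + 1)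
      ≤ ∏ p ∈ n.primeFactors, (if p < B then K else 1) * ((p : ℝ) ^ n.factorization p) ^ δ := by
        refine prod_le_prod (fun _ _ => by positivity) fun p hp => ?_
        split_ifs with h
        · exact succ_le_mul_rpow_mul hδ (Nat.prime_of_mem_primeFactors hp).two_le _
        · rw [one_mul]
          exact succ_le_rpow_of_two_le_rpow (hlarge p (by omega)) _
    _ = K ^ #{p ∈ n.primeFactors | p < B} *
        ∏ p ∈ n.primeFactors, ((p : ℝ) ^ n.factorization p) ^ δ := by
        rw [prod_mul_distrib, ← prod_filter, prod_const]
    _ ≤ _ := by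
        gcongr
        calc _ ≤ #(range B) := card_le_card fun p hp => mem_range.2 (mem_filter.1 hp).2
          _ = B := card_range B

lemma exists_nat_bound_card_divisors {δ : ℝ} (hδ : 0 < δ) :
    ∃ C : ℝ, 1 ≤ C ∧ ∀ N : ℕ, 1 ≤ N → ∃ D : ℕ,
      (∀ m, 1 ≤ m → m ≤ 2 * N ^ 4 → #m.divisors ≤ D) ∧ 1 + Real.log N ≤ D ∧
        (D : ℝ) ≤ C * (N : ℝ) ^ δ := by
  obtain ⟨C₀, hC₀, h⟩ := exists_card_divisors_le_mul_rpow (δ := δ / 4) (by positivity)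
  have h2 : (0 : ℝ) < 2 ^ (δ / 4) := by positivity
  have hδ' : 0 < 1 / δ := by positivity
  refine ⟨C₀ * 2 ^ (δ / 4) + 2 + 1 / δ, by nlinarith, fun N hN => ?_⟩
  have hN1 : (1 : ℝ) ≤ N := by exact_mod_cast hN
  have hNδ : 1 ≤ (N : ℝ) ^ δ := Real.one_le_rpow hN1 hδ.le
  have hlog0 : 0 ≤ Real.log N := Real.log_natCast_nonneg N
  have hlog : Real.log N ≤ (N : ℝ) ^ δ / δ := Real.log_le_rpow_div (by positivity) hδ
  have he : C₀ * (2 * (N : ℝ) ^ 4) ^ (δ / 4) = C₀ * 2 ^ (δ / 4) * (N : ℝ) ^ δ := by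
    rw [Real.mul_rpow (by norm_num) (by positivity), ← Real.rpow_natCast, ← Real.rpow_mul
      (by positivity), mul_assoc]
    congr 3
    push_cast
    ring
  have hX : 0 ≤ C₀ * (2 * (N : ℝ) ^ 4) ^ (δ / 4) := by positivity
  refine ⟨⌈C₀ * (2 * (N : ℝ) ^ 4) ^ (δ / 4) + 1 + Real.log N⌉₊, fun m hm1 hm2 => ?_, ?_, ?_⟩
  · have h3 : (m : ℝ) ≤ 2 * (N : ℝ) ^ 4 := by exact_mod_cast hm2
    have h4 : C₀ * (m : ℝ) ^ (δ / 4) ≤ C₀ * (2 * (N : ℝ) ^ 4) ^ (δ / 4) := by gcongr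
    have h5 := Nat.le_ceil (C₀ * (2 * (N : ℝ) ^ 4) ^ (δ / 4) + 1 + Real.log N)
    have h6 := h m hm1
    have : (#m.divisors : ℝ) ≤ (⌈C₀ * (2 * (N : ℝ) ^ 4) ^ (δ / 4) + 1 + Real.log N⌉₊ : ℝ) := by
      linarith
    exact_mod_cast this
  · have h5 := Nat.le_ceil (C₀ * (2 * (N : ℝ) ^ 4) ^ (δ / 4) + 1 + Real.log N)
    linarith
  · have h5 := Nat.ceil_lt_add_one (add_nonneg (add_nonneg hX zero_le_one) hlog0)
    rw [he] at h5 ⊢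
    have h7 : (N : ℝ) ^ δ / δ = 1 / δ * (N : ℝ) ^ δ := by ring
    nlinarith

lemma norm_sum_prime_sub_sum_vonMangoldt_le {k : ℕ} (hk : 1 ≤ k) (f : ℕ → ℂ)
    (hf : ∀ n, ‖f n‖ ≤ 1) :
    ‖∑ n ∈ Ioc 0 k, (if n.Prime then f n * (Real.log n : ℂ) else 0) -
      ∑ n ∈ Ioc 0 k, (ArithmeticFunction.vonMangoldt n : ℂ) * f n‖ ≤
        2 * √(k : ℝ) * Real.log k := by
  have h1 := Chebyshev.psi_sub_theta_le (x := k) (by exact_mod_cast hk)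
  rw [Chebyshev.psi_sub_theta_eq_sum_not_prime, Nat.floor_natCast, sum_filter] at h1
  refine le_trans ?_ h1
  rw [← sum_sub_distrib]
  refine norm_sum_le_of_le _ fun n _ => ?_
  by_cases hp : n.Prime
  · rw [if_pos hp, if_neg (not_not.2 hp), ArithmeticFunction.vonMangoldt_apply_prime hp, mul_comm]
    simp
  · rw [if_neg hp, if_pos hp, zero_sub, norm_neg, norm_mul, Complex.norm_real, Real.norm_eq_abs,
      abs_of_nonneg ArithmeticFunction.vonMangoldt_nonneg]
    exact mul_le_of_le_one_right ArithmeticFunction.vonMangoldt_nonneg (hf n)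

lemma norm_sum_prime_le {N D k : ℕ} (hlog : 1 + Real.log N ≤ D) (hk : k ≤ N) (f : ℕ → ℂ)
    (hf : ∀ n, ‖f n‖ ≤ 1) :
    ‖∑ n ∈ Ioc 0 k, (if n.Prime then f n * (Real.log n : ℂ) else 0)‖ ≤
      ‖∑ n ∈ Ioc 0 k, (ArithmeticFunction.vonMangoldt n : ℂ) * f n‖ + 2 * √(N : ℝ) * D := by
  rcases Nat.eq_zero_or_pos k with rfl | hk0
  · simp
    positivity
  · have h1 := norm_sum_prime_sub_sum_vonMangoldt_le hk0 f hf
    have h2 : 2 * √(k : ℝ) * Real.log k ≤ 2 * √(N : ℝ) * D := by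
      have h3 : (k : ℝ) ≤ N := by exact_mod_cast hk
      gcongr
      exact log_natCast_le_of_le hlog hk
    linarith [norm_le_insert' (∑ n ∈ Ioc 0 k, (if n.Prime then f n * (Real.log n : ℂ) else 0))
      (∑ n ∈ Ioc 0 k, (ArithmeticFunction.vonMangoldt n : ℂ) * f n)]

lemma exists_norm_sum_prime_rpow_le {N D R : ℕ} {γ : ℝ} (hlog : 1 + Real.log N ≤ D) (hR : 1 ≤ R)
    (hγ : γ < 1) (f : ℕ → ℂ) (hf : ∀ n, ‖f n‖ ≤ 1) :
    ∃ k ≤ N, ‖∑ p ∈ (range (N + 1)).filter Nat.Prime,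
        (((p : ℝ) ^ (γ - 1) : ℝ) : ℂ) * f p * (Real.log p : ℂ)‖ ≤
      R * D + (R : ℝ) ^ (γ - 1) *
        (‖∑ n ∈ Ioc 0 k, (ArithmeticFunction.vonMangoldt n : ℂ) * f n‖ + 2 * √(N : ℝ) * D) := by
  set z : ℕ → ℂ := fun n => if n.Prime then f n * (Real.log n : ℂ) else 0 with hz
  set v : ℕ → ℝ := fun n => ((max n R : ℕ) : ℝ) ^ (γ - 1) with hv
  have hR0 : (0 : ℝ) < R := by exact_mod_cast hR
  have hanti : Antitone v := by
    intro m n hmn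
    have h1 : (0 : ℝ) < ((max m R : ℕ) : ℝ) := by
      exact_mod_cast lt_of_lt_of_le hR (le_max_right m R)
    have h2 : ((max m R : ℕ) : ℝ) ≤ ((max n R : ℕ) : ℝ) := by
      exact_mod_cast max_le_max hmn le_rfl
    exact Real.rpow_le_rpow_of_nonpos h1 h2 (by linarith)
  obtain ⟨k, hk, hle⟩ := exists_norm_sum_mul_le_of_antitone hanti (fun n => by positivity) z
    (L := (R : ℝ) ^ (γ - 1)) N (by simp [hv])
  refine ⟨k, hk, ?_⟩
  have hsum : ∑ p ∈ (range (N + 1)).filter Nat.Prime,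
      (((p : ℝ) ^ (γ - 1) : ℝ) : ℂ) * f p * (Real.log p : ℂ) =
        ∑ n ∈ Ioc 0 N, (((n : ℝ) ^ (γ - 1) : ℝ) : ℂ) * z n := by
    have : (range (N + 1)).filter Nat.Prime = (Ioc 0 N).filter Nat.Prime := by
      ext p
      simp only [mem_filter, mem_range, mem_Ioc]
      exact ⟨fun h => ⟨⟨h.2.pos, by omega⟩, h.2⟩, fun h => ⟨by omega, h.2⟩⟩
    rw [this, sum_filter]
    refine sum_congr rfl fun n _ => ?_
    simp only [hz]
    split_ifs
    · ring
    · simp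
  have hdiff : ‖∑ n ∈ Ioc 0 N, (((n : ℝ) ^ (γ - 1) : ℝ) : ℂ) * z n -
      ∑ n ∈ Ioc 0 N, (v n : ℂ) * z n‖ ≤ R * D := by
    rw [← sum_sub_distrib]
    calc _ ≤ ∑ n ∈ Ioc 0 N, if n ≤ R then (D : ℝ) else 0 := by
          refine norm_sum_le_of_le _ fun n hn => ?_
          rw [mem_Ioc] at hn
          have hn1 : (1 : ℝ) ≤ n := by exact_mod_cast hn.1
          split_ifs with h
          · rw [← sub_mul, ← Complex.ofReal_sub, norm_mul, Complex.norm_real, Real.norm_eq_abs]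
            have h1 : |(n : ℝ) ^ (γ - 1) - v n| ≤ 1 := by
              have h2 : (n : ℝ) ^ (γ - 1) ≤ 1 := Real.rpow_le_one_of_one_le_of_nonpos hn1
                (by linarith)
              have h3 : 0 ≤ v n := by positivity
              have h4 : v n ≤ (n : ℝ) ^ (γ - 1) := by
                refine Real.rpow_le_rpow_of_nonpos (by linarith) ?_ (by linarith)
                exact_mod_cast le_max_left n R
              rw [abs_of_nonneg (by linarith)]
              linarith
            have h5 : ‖z n‖ ≤ D := by
              simp only [hz]
              split_ifs
              · rw [norm_mul, Complex.norm_real, Real.norm_eq_abs,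
                  abs_of_nonneg (Real.log_natCast_nonneg n)]
                calc _ ≤ 1 * (D : ℝ) := by
                      gcongr
                      · exact hf n
                      · exact log_natCast_le_of_le hlog hn.2
                  _ = D := one_mul _
              · simp
            calc _ ≤ 1 * (D : ℝ) := by gcongr
              _ = D := one_mul _
          · have : v n = (n : ℝ) ^ (γ - 1) := by
              simp only [hv]
              rw [max_eq_left (by omega)]
            rw [this]
            simp
      _ = #{n ∈ Ioc 0 N | n ≤ R} * (D : ℝ) := by
          rw [← sum_filter, sum_const, nsmul_eq_mul]
      _ ≤ R * D := by
          gcongr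
          calc _ ≤ #(Ioc 0 R) := card_le_card fun n hn => by
                simp only [mem_filter, mem_Ioc] at hn ⊢
                omega
            _ = R := by simp
  rw [hsum]
  have h6 : (R : ℝ) ^ (γ - 1) * ‖∑ n ∈ Ioc 0 k, z n‖ ≤ (R : ℝ) ^ (γ - 1) *
      (‖∑ n ∈ Ioc 0 k, (ArithmeticFunction.vonMangoldt n : ℂ) * f n‖ + 2 * √(N : ℝ) * D) := by
    gcongr
    exact norm_sum_prime_le hlog hk f hf
  linarith [norm_le_insert' (∑ n ∈ Ioc 0 N, (((n : ℝ) ^ (γ - 1) : ℝ) : ℂ) * z n)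
    (∑ n ∈ Ioc 0 N, (v n : ℂ) * z n)]

lemma sum_norm_prime_rpow_le {N q u D w R : ℕ} {γ : ℝ} (hR : 1 ≤ R) (hγ : γ < 1) (hw : 1 ≤ w)
    (hu : 1 ≤ u) (huN : u ≤ N) (hqN : q ≤ N) (hwq : w ^ 11 ≤ q)
    (hD : ∀ m, 1 ≤ m → m ≤ 2 * N ^ 4 → #m.divisors ≤ D)
    (hlog : 1 + Real.log N ≤ D) {α : ℝ} {a : ℤ} (hirr : Irrational α) (hcop : Int.gcd a q = 1)
    (hα : |α - (a : ℝ) / (q : ℝ)| < 1 / (q : ℝ) ^ 2) :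
    ∑ h ∈ Icc 1 u, ‖∑ p ∈ (range (N + 1)).filter Nat.Prime,
        (((p : ℝ) ^ (γ - 1) : ℝ) : ℂ) * e2pi (α * (h : ℝ) * (p : ℝ) ^ 2) * (Real.log p : ℂ)‖ ≤
      u * (R * D + (R : ℝ) ^ (γ - 1) * (32 * (D : ℝ) ^ 3 * N / √w + 2 * √(N : ℝ) * D)) := by
  have hex := fun h : ℕ => exists_norm_sum_prime_rpow_le (γ := γ) hlog hR hγ
    (fun n => e2pi (α * (h : ℝ) * (n : ℝ) ^ 2)) fun n => (norm_e2pi _).le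
  choose M hM hle using hex
  have hS := sum_norm_vonMangoldt_le hw hu huN hqN hwq hD hlog hirr hcop hα M hM
  calc _ ≤ _ := sum_le_sum fun h _ => hle h
    _ = (u : ℝ) * (R * D) + (R : ℝ) ^ (γ - 1) * (∑ h ∈ Icc 1 u, ‖∑ n ∈ Ioc 0 (M h),
          (ArithmeticFunction.vonMangoldt n : ℂ) * e2pi (α * (h : ℝ) * (n : ℝ) ^ 2)‖ +
            u * (2 * √(N : ℝ) * D)) := by
        rw [sum_add_distrib, sum_const, ← mul_sum, sum_add_distrib]
        simp
    _ ≤ (u : ℝ) * (R * D) + (R : ℝ) ^ (γ - 1) * (32 * (D : ℝ) ^ 3 * u * N / √w +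
            u * (2 * √(N : ℝ) * D)) := by gcongr
    _ = _ := by ring

lemma add_rpow_mul_add_le_rpow {X N D w C γ ε : ℝ} {R : ℕ} (hγ1 : 13 / 14 < γ) (hγ2 : γ < 1)
    (hε : 0 < ε) (hX : 1 ≤ X) (hN0 : 0 ≤ N) (hNX : N ≤ X) (hC : 1 ≤ C) (hD0 : 0 ≤ D)
    (hD : D ≤ C * X ^ (ε / 3)) (hw : X ^ (1 / 12 : ℝ) ≤ 2 * w)
    (hR1 : X ^ (13 / 14 : ℝ) ≤ R) (hR2 : (R : ℝ) ≤ 2 * X ^ (13 / 14 : ℝ)) :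
    R * D + (R : ℝ) ^ (γ - 1) * (32 * D ^ 3 * N / √w + 2 * √N * D) ≤
      68 * C ^ 3 * X ^ ((15 * γ + 13) / 29 + ε) := by
  have hX0 : 0 < X := by linarith
  have hC13 : C ≤ C ^ 3 := le_self_pow₀ hC (by norm_num)
  have hmono : ∀ {s : ℝ}, s ≤ (15 * γ + 13) / 29 + ε → X ^ s ≤ X ^ ((15 * γ + 13) / 29 + ε) :=
    fun hs => Real.rpow_le_rpow_of_exponent_le hX hs
  have hXpos : 0 < X ^ ((15 * γ + 13) / 29 + ε) := by positivity
  set Y := X ^ ((15 * γ + 13) / 29 + ε) with hY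
  have t1 : R * D ≤ 2 * C ^ 3 * Y := by
    calc R * D ≤ (2 * X ^ (13 / 14 : ℝ)) * (C * X ^ (ε / 3)) := by gcongr
      _ = 2 * C * X ^ (13 / 14 + ε / 3 : ℝ) := by rw [Real.rpow_add hX0]; ring
      _ ≤ 2 * C ^ 3 * Y := by
        gcongr
        exact hmono (by linarith)
  have hRpow : (R : ℝ) ^ (γ - 1) ≤ X ^ ((13 / 14 : ℝ) * (γ - 1)) := by
    rw [Real.rpow_mul hX0.le]
    exact Real.rpow_le_rpow_of_nonpos (by positivity) hR1 (by linarith)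
  have hRpow1 : (R : ℝ) ^ (γ - 1) ≤ 1 :=
    Real.rpow_le_one_of_one_le_of_nonpos
      ((Real.one_le_rpow hX (by norm_num)).trans hR1) (by linarith)
  have hRpow0 : 0 ≤ (R : ℝ) ^ (γ - 1) := by positivity
  have t2 : (R : ℝ) ^ (γ - 1) * (2 * √N * D) ≤ 2 * C ^ 3 * Y := by
    calc _ ≤ 1 * (2 * X ^ (1 / 2 : ℝ) * (C * X ^ (ε / 3))) := by
          gcongr
          rw [Real.sqrt_eq_rpow]
          gcongr
      _ = 2 * C * X ^ (1 / 2 + ε / 3 : ℝ) := by rw [Real.rpow_add hX0]; ring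
      _ ≤ 2 * C ^ 3 * Y := by
        gcongr
        exact hmono (by linarith)
  have hsw : X ^ (1 / 24 : ℝ) / 2 ≤ √w := by
    refine Real.le_sqrt_of_sq_le ?_
    have : (X ^ (1 / 24 : ℝ)) ^ 2 = X ^ (1 / 12 : ℝ) := by
      rw [← Real.rpow_natCast, ← Real.rpow_mul hX0.le]
      norm_num
    rw [div_pow, this]
    have : 0 < X ^ (1 / 12 : ℝ) := by positivity
    linarith
  have t3 : (R : ℝ) ^ (γ - 1) * (32 * D ^ 3 * N / √w) ≤ 64 * C ^ 3 * Y := by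
    calc _ ≤ X ^ ((13 / 14 : ℝ) * (γ - 1)) * (32 * (C * X ^ (ε / 3)) ^ 3 * X /
            (X ^ (1 / 24 : ℝ) / 2)) := by gcongr
      _ = 64 * C ^ 3 * (X ^ ((13 / 14 : ℝ) * (γ - 1)) * (X ^ (ε / 3)) ^ 3 * X *
            (X ^ (1 / 24 : ℝ))⁻¹) := by
          field_simp
          ring
      _ = 64 * C ^ 3 * X ^ ((13 / 14 : ℝ) * (γ - 1) + ε + 1 + -(1 / 24)) := by
          rw [Real.rpow_add hX0, Real.rpow_add hX0, Real.rpow_add hX0, Real.rpow_one,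
            Real.rpow_neg hX0.le, ← Real.rpow_natCast (X ^ (ε / 3)), ← Real.rpow_mul hX0.le]
          norm_num
      _ ≤ 64 * C ^ 3 * Y := by
        gcongr
        exact hmono (by linarith)
  rw [mul_add]
  linarith

end

theorem frakS_bound (γ ε : ℝ) (hγ1 : 13 / 14 < γ) (hγ2 : γ < 1) (hε : 0 < ε) :
    ∃ C > 0, ∃ q₀ : ℕ, ∀ (α : ℝ) (a : ℤ) (q : ℕ) (u : ℝ),
      Irrational α → q₀ ≤ q → 2 ≤ q → Int.gcd a (q : ℤ) = 1 → a ≠ 0 →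
      |α - (a : ℝ) / (q : ℝ)| < 1 / (q : ℝ) ^ 2 →
      1 ≤ u → u ≤ (⌊Real.sqrt q⌋₊ : ℝ) →
      ∑ h ∈ Finset.Icc 1 ⌊u⌋₊,
        ‖∑ p ∈ (Finset.range (⌊(q : ℝ) ^ (29 / (55 - 28 * γ))⌋₊ + 1)).filter Nat.Prime,
            (((p : ℝ) ^ (γ - 1) : ℝ) : ℂ) * e2pi (α * (h : ℝ) * (p : ℝ) ^ 2) *
              (Real.log p : ℂ)‖ ≤
      C * u * ((q : ℝ) ^ (29 / (55 - 28 * γ))) ^ ((15 * γ + 13) / 29 + ε) := by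
  obtain ⟨C, hC, hdiv⟩ := exists_nat_bound_card_divisors (δ := ε / 3) (by positivity)
  refine ⟨68 * C ^ 3, by positivity, 2, fun α a q u hirr _ hq hcop _ hα hu1 hu2 => ?_⟩
  have hq1 : (1 : ℝ) ≤ q := by exact_mod_cast (by omega : 1 ≤ q)
  have he0 : 0 < 55 - 28 * γ := by linarith
  have he1 : 1 ≤ 29 / (55 - 28 * γ) := by rw [le_div_iff₀ he0]; linarith
  have he2 : 29 / (55 - 28 * γ) ≤ 12 / 11 := by rw [div_le_div_iff₀ he0 (by norm_num)]; linarith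
  set e := 29 / (55 - 28 * γ) with he
  set X := (q : ℝ) ^ e with hX
  have hqX : (q : ℝ) ≤ X := Real.self_le_rpow_of_one_le hq1 he1
  have hX1 : 1 ≤ X := hq1.trans hqX
  have hqN : q ≤ ⌊X⌋₊ := Nat.le_floor hqX
  obtain ⟨D, hD1, hD2, hD3⟩ := hdiv ⌊X⌋₊ (by omega)
  have hNX : (⌊X⌋₊ : ℝ) ≤ X := Nat.floor_le (by linarith)
  have huq : ⌊u⌋₊ ≤ q := by
    have h1 : (⌊√(q : ℝ)⌋₊ : ℝ) ≤ √(q : ℝ) := Nat.floor_le (Real.sqrt_nonneg _)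
    have h2 : √(q : ℝ) ≤ q := Real.sqrt_le_iff.2 ⟨by linarith, by nlinarith⟩
    exact Nat.floor_le_of_le (by linarith)
  have hw1 : 1 ≤ X ^ (1 / 12 : ℝ) := Real.one_le_rpow hX1 (by norm_num)
  have hw : 1 ≤ ⌊X ^ (1 / 12 : ℝ)⌋₊ := Nat.le_floor (by exact_mod_cast hw1)
  have hwq : ⌊X ^ (1 / 12 : ℝ)⌋₊ ^ 11 ≤ q := by
    have h1 : (⌊X ^ (1 / 12 : ℝ)⌋₊ : ℝ) ^ 11 ≤ q := by
      calc (⌊X ^ (1 / 12 : ℝ)⌋₊ : ℝ) ^ 11 ≤ (X ^ (1 / 12 : ℝ)) ^ 11 := by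
            gcongr
            exact Nat.floor_le (by linarith)
        _ = (q : ℝ) ^ (e * (11 / 12)) := by
            rw [hX, ← Real.rpow_natCast, ← Real.rpow_mul (by positivity),
              ← Real.rpow_mul (by positivity)]
            congr 1
            push_cast
            ring
        _ ≤ (q : ℝ) ^ (1 : ℝ) := Real.rpow_le_rpow_of_exponent_le hq1 (by linarith)
        _ = q := Real.rpow_one _
    exact_mod_cast h1
  have hR1 : 1 ≤ X ^ (13 / 14 : ℝ) := Real.one_le_rpow hX1 (by norm_num)
  have hR : 1 ≤ ⌈X ^ (13 / 14 : ℝ)⌉₊ := Nat.one_le_ceil_iff.2 (by linarith)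
  have hmain := sum_norm_prime_rpow_le hR hγ2 hw (Nat.le_floor (by exact_mod_cast hu1))
    (huq.trans hqN) hqN hwq hD1 hD2 hirr hcop hα
  have hterms := add_rpow_mul_add_le_rpow (R := ⌈X ^ (13 / 14 : ℝ)⌉₊) (D := D)
    (w := ⌊X ^ (1 / 12 : ℝ)⌋₊) hγ1 hγ2 hε hX1
    (Nat.cast_nonneg _) hNX hC (Nat.cast_nonneg D) (hD3.trans (by gcongr))
    (by
      have h1 := Nat.lt_floor_add_one (X ^ (1 / 12 : ℝ))
      have h2 : (1 : ℝ) ≤ ⌊X ^ (1 / 12 : ℝ)⌋₊ := by exact_mod_cast hw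
      linarith)
    (Nat.le_ceil _)
    (by
      have h1 := Nat.ceil_lt_add_one (a := X ^ (13 / 14 : ℝ)) (by linarith)
      linarith)
  calc _ ≤ _ := hmain
    _ ≤ u * (68 * C ^ 3 * X ^ ((15 * γ + 13) / 29 + ε)) := by
        gcongr
        exact Nat.floor_le (by linarith)
    _ = _ := by ring
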